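/- arXiv:1805.10353 — 12 statements merged into one kernel-verified Lean document; each statement's English description precedes it below -/
import Mathlib

section
/- Let λ : ℝ → [0,∞) be locally integrable and let G be a distribution function supported on [0,∞), with tail Ḡ(u) := 1 − G(u) for u ≥ 0 and Ḡ(u) := 1 for u < 0. Set H(t) := ∫₀^∞ Ḡ(u) λ(t−u) du and assume H(t₁) < ∞ and H(t₂) < ∞ for fixed reals t₁ < t₂. Then for all θ₁, θ₂ ∈ ℝ: ∫_{−∞}^{∞} (e^{θ₁·𝟙(x≤t₁)} − 1)[Ḡ(t₁−x) − Ḡ(t₂−x)] λ(x) dx + ∫_{−∞}^{∞} (e^{θ₁·𝟙(x≤t₁) + θ₂·𝟙(x≤t₂)} − 1) Ḡ(t₂−x) λ(x) dx = (e^{θ₁} − 1) H(t₁) + (e^{θ₂} − 1) H(t₂) + (e^{θ₁} − 1)(e^{θ₂} − 1) ∫_{t₂−t₁}^{∞} Ḡ(u) λ(t₂−u) du. -/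
open MeasureTheory Set

theorem preimage_sub_left_Iio (t c : ℝ) : (fun u : ℝ => t - u) ⁻¹' Iio (t - c) = Ioi c := by
  ext u
  simp

/-- Reflection `u ↦ t - u` carries a half-line integral to a half-line integral. -/
theorem setIntegral_Ioi_reflect (f g : ℝ → ℝ) (t c : ℝ) :
    ∫ u in Ioi c, f u * g (t - u) = ∫ x in Iic (t - c), f (t - x) * g x := by
  have hpres := Measure.measurePreserving_sub_left (volume : Measure ℝ) t
  have h := hpres.setIntegral_preimage_emb (MeasurableEquiv.subLeft t).measurableEmbedding
    (fun x => f (t - x) * g x) (Iio (t - c))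
  rw [preimage_sub_left_Iio] at h
  rw [integral_Iic_eq_integral_Iio, ← h]
  simp

theorem integrableOn_Iic_of_reflect {f g : ℝ → ℝ} {t : ℝ}
    (h : IntegrableOn (fun u => f u * g (t - u)) (Ioi 0)) :
    IntegrableOn (fun x => f (t - x) * g x) (Iic t) := by
  have hpres := Measure.measurePreserving_sub_left (volume : Measure ℝ) t
  rw [integrableOn_Iic_iff_integrableOn_Iio,
    ← hpres.integrableOn_comp_preimage (MeasurableEquiv.subLeft t).measurableEmbedding]
  have hpre := preimage_sub_left_Iio t 0
  rw [sub_zero] at hpre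
  rw [hpre]
  simpa [Function.comp_def] using h

/-- Two-time-point core of the joint MGF formula for the `M_t/G/∞` queue. -/
theorem statement0
    (lam G Gbar H : ℝ → ℝ)
    (hlam_nonneg : ∀ x, 0 ≤ lam x)
    (hlam_loc : LocallyIntegrable lam)
    (hG_mono : Monotone G) (hG_nonneg : ∀ u, 0 ≤ G u) (hG_le_one : ∀ u, G u ≤ 1)
    (hG_supp : ∀ u < (0:ℝ), G u = 0)
    (hGbar : ∀ u, Gbar u = if u < 0 then 1 else 1 - G u)
    (hH : ∀ t, H t = ∫ u in Ioi (0:ℝ), Gbar u * lam (t - u))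
    (t₁ t₂ : ℝ) (ht : t₁ < t₂)
    (hH₁ : IntegrableOn (fun u => Gbar u * lam (t₁ - u)) (Ioi 0))
    (hH₂ : IntegrableOn (fun u => Gbar u * lam (t₂ - u)) (Ioi 0))
    (θ₁ θ₂ : ℝ) :
    (∫ x : ℝ, (Real.exp (θ₁ * (if x ≤ t₁ then 1 else 0)) - 1) *
        ((Gbar (t₁ - x) - Gbar (t₂ - x)) * lam x))
      + (∫ x : ℝ, (Real.exp (θ₁ * (if x ≤ t₁ then 1 else 0)
            + θ₂ * (if x ≤ t₂ then 1 else 0)) - 1) * (Gbar (t₂ - x) * lam x))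
    = (Real.exp θ₁ - 1) * H t₁ + (Real.exp θ₂ - 1) * H t₂
      + (Real.exp θ₁ - 1) * (Real.exp θ₂ - 1) *
          ∫ u in Ioi (t₂ - t₁), Gbar u * lam (t₂ - u) := by
  have hI₁ := integrableOn_Iic_of_reflect hH₁
  have hI₂ := integrableOn_Iic_of_reflect hH₂
  have hI₂₁ := hI₂.mono_set (Iic_subset_Iic.2 ht.le)
  rw [hH t₁, hH t₂, setIntegral_Ioi_reflect, setIntegral_Ioi_reflect, setIntegral_Ioi_reflect,
    sub_zero, sub_zero, sub_sub_cancel]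
  set f₁ : ℝ → ℝ := fun x => Gbar (t₁ - x) * lam x
  set f₂ : ℝ → ℝ := fun x => Gbar (t₂ - x) * lam x
  have e₁ : (fun x : ℝ => (Real.exp (θ₁ * (if x ≤ t₁ then 1 else 0)) - 1) *
        ((Gbar (t₁ - x) - Gbar (t₂ - x)) * lam x)) =
      fun x => (Real.exp θ₁ - 1) * ((Iic t₁).indicator f₁ x - (Iic t₁).indicator f₂ x) := by
    ext x
    by_cases hx : x ≤ t₁ <;> simp [hx, f₁, f₂, indicator, sub_mul]
  have e₂ : (fun x : ℝ => (Real.exp (θ₁ * (if x ≤ t₁ then 1 else 0)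
            + θ₂ * (if x ≤ t₂ then 1 else 0)) - 1) * (Gbar (t₂ - x) * lam x)) =
      fun x => ((Real.exp θ₁ - 1) * Real.exp θ₂) * (Iic t₁).indicator f₂ x
        + (Real.exp θ₂ - 1) * (Iic t₂).indicator f₂ x := by
    ext x
    by_cases hx : x ≤ t₁
    · simp only [hx, hx.trans ht.le, f₂, indicator, mem_Iic, if_true, mul_one, Real.exp_add]
      ring
    · by_cases hx' : x ≤ t₂ <;> simp [hx, hx', f₂, indicator]
  have j₁ := hI₁.integrable_indicator measurableSet_Iic
  have j₂ := hI₂.integrable_indicator measurableSet_Iic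
  have j₂₁ := hI₂₁.integrable_indicator measurableSet_Iic
  rw [e₁, e₂, integral_const_mul, integral_sub j₁ j₂₁,
    integral_add (j₂₁.const_mul _) (j₂.const_mul _), integral_const_mul, integral_const_mul,
    integral_indicator measurableSet_Iic, integral_indicator measurableSet_Iic,
    integral_indicator measurableSet_Iic]
  ring
end

section
/- Let λ : ℝ → [0,∞) be locally integrable, supported on [0,∞), whose Laplace transform λ̂(z) = ∫₀^∞ e^{−zt} λ(t) dt converges absolutely for Re(z) > σ_λ (σ_λ ≥ 0) and has no zeros there. Let G be a distribution function supported on [0,∞) with Ḡ = 1 − G, and set H(t) = ∫₀^∞ Ḡ(u) λ(t−u) du. Let K : ℝ → ℝ be a bounded function supported on [0,1] with bilateral Laplace transform K̂(z) = ∫₀^1 e^{−zt} K(t) dt, and for h > 0 and fixed s < −σ_λ define L_h(t) := (e^{st}/(2π)) ∫_{−∞}^{∞} [K̂((s+iω)h)/λ̂(−s−iω)] e^{iωt} dω. If ∫_{−∞}^{∞} |K̂((s+iω)h)/λ̂(−s−iω)| dω < ∞ and ∫₀^∞ |L_h(t−x₀)| H(t) dt < ∞ for every x₀, then for every x₀ >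 0: ∫₀^∞ L_h(t−x₀) H(t) dt = ∫_{−∞}^{∞} (1/h) K((x−x₀)/h) Ḡ(x) dx. -/
open MeasureTheory Set
open scoped FourierTransform

theorem continuous_fourier_of_integrable {f : ℝ → ℂ} (hf : Integrable f) : Continuous (𝓕 f) :=
  VectorFourier.fourierIntegral_continuous Real.continuous_fourierChar
    (L := innerₗ ℝ) continuous_inner hf

theorem continuous_fourierInv_of_integrable {f : ℝ → ℂ} (hf : Integrable f) :
    Continuous (𝓕⁻ f) := by
  rw [Real.fourierInv_eq_fourier_comp_neg]
  exact continuous_fourier_of_integrable hf.comp_neg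

theorem norm_fourierInv_le_integral_norm (f : ℝ → ℂ) (x : ℝ) : ‖𝓕⁻ f x‖ ≤ ∫ v, ‖f v‖ :=
  VectorFourier.norm_fourierIntegral_le_integral_norm _ _ _ _ _

/-- The inverse Fourier transform is self-adjoint for the bilinear pairing of integrable
functions. -/
theorem integral_fourierInv_mul_eq {f g : ℝ → ℂ} (hf : Integrable f) (hg : Integrable g) :
    ∫ ξ, 𝓕⁻ f ξ * g ξ = ∫ x, f x * 𝓕⁻ g x := by
  have := VectorFourier.integral_fourierIntegral_smul_eq_flip (L := -innerₗ ℝ) (μ := volume)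
    (ν := volume) Real.continuous_fourierChar (continuous_inner (𝕜 := ℝ)).neg hf hg
  have hflip : (-innerₗ ℝ : ℝ →ₗ[ℝ] ℝ →ₗ[ℝ] ℝ).flip = -innerₗ ℝ := by
    ext; simp
  rw [hflip] at this
  exact this

theorem integral_fourier_mul_eq {f g : ℝ → ℂ} (hf : Integrable f) (hg : Integrable g) :
    ∫ ξ, 𝓕 f ξ * g ξ = ∫ x, f x * 𝓕 g x := by
  have := VectorFourier.integral_fourierIntegral_smul_eq_flip (L := innerₗ ℝ) (μ := volume)
    (ν := volume) Real.continuous_fourierChar continuous_inner hf hg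
  rw [flip_innerₗ] at this
  exact this

/-- Fourier inversion for integrable functions with integrable Fourier transform, without
continuity: the inversion formula holds almost everywhere. -/
theorem fourierInv_fourier_ae_eq {f : ℝ → ℂ} (hf : Integrable f) (hf' : Integrable (𝓕 f)) :
    𝓕⁻ (𝓕 f) =ᵐ[volume] f := by
  refine ae_eq_of_integral_contDiff_smul_eq
    (continuous_fourierInv_of_integrable hf').locallyIntegrable hf.locallyIntegrable
    fun g hg hgc ↦ ?_
  have hG : ContDiff ℝ (⊤ : ℕ∞) (fun x ↦ (g x : ℂ)) := Complex.ofRealCLM.contDiff.comp hg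
  have hGc : HasCompactSupport (fun x ↦ (g x : ℂ)) := hgc.comp_left (g := Complex.ofReal) rfl
  set φ : SchwartzMap ℝ ℂ := hGc.toSchwartzMap hG
  have hφg (x : ℝ) : φ x = (g x : ℂ) := rfl
  simp only [Complex.real_smul, ← hφg]
  have h1 : 𝓕⁻ (φ : ℝ → ℂ) = (𝓕⁻ φ : SchwartzMap ℝ ℂ) := (SchwartzMap.fourierInv_coe φ).symm
  calc ∫ x, φ x * 𝓕⁻ (𝓕 f) x = ∫ x, 𝓕⁻ (φ : ℝ → ℂ) x * 𝓕 f x :=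
        (integral_fourierInv_mul_eq φ.integrable hf').symm
    _ = ∫ x, 𝓕 f x * (𝓕⁻ φ : SchwartzMap ℝ ℂ) x := by simp_rw [h1, mul_comm]
    _ = ∫ x, f x * 𝓕 ((𝓕⁻ φ : SchwartzMap ℝ ℂ) : ℝ → ℂ) x :=
        integral_fourier_mul_eq hf (𝓕⁻ φ : SchwartzMap ℝ ℂ).integrable
    _ = ∫ x, φ x * f x := by
        simp_rw [← SchwartzMap.fourier_coe, FourierTransform.fourier_fourierInv_eq, mul_comm]

theorem fourierInv_add_right (f : ℝ → ℂ) (x y : ℝ) :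
    𝓕⁻ f (x + y) = 𝓕⁻ (fun ξ ↦ (𝐞 (ξ * y) : ℂ) * f ξ) x := by
  simp only [Real.fourierInv_eq, Circle.smul_def, smul_eq_mul]
  congr 1 with ξ
  simp only [AddChar.map_add_eq_mul, RCLike.inner_apply, conj_trivial, mul_comm ξ,
    Circle.coe_mul, add_mul]
  ring

/-- If `P * 𝓕⁻ l = 𝓕 k`, then correlating `𝓕⁻ P` with `l` recovers `k`. -/
theorem integral_fourierInv_mul_ae_eq {l k P : ℝ → ℂ} (hl : Integrable l) (hk : Integrable k)
    (hP : Integrable P) (hPl : ∀ ξ, P ξ * 𝓕⁻ l ξ = 𝓕 k ξ) :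
    (fun y ↦ ∫ v, 𝓕⁻ P (v + y) * l v) =ᵐ[volume] k := by
  have hk' : Integrable (𝓕 k) := by
    simp_rw [← funext hPl]
    exact hP.mul_bdd (c := ∫ v, ‖l v‖) (continuous_fourierInv_of_integrable hl).aestronglyMeasurable
      (.of_forall (norm_fourierInv_le_integral_norm l))
  refine Filter.EventuallyEq.trans (.of_forall fun y ↦ ?_) (fourierInv_fourier_ae_eq hk hk')
  have hPy : Integrable (fun ξ ↦ (𝐞 (ξ * y) : ℂ) * P ξ) :=
    hP.bdd_mul (c := 1) 
      (Continuous.aestronglyMeasurable (by fun_prop)) (.of_forall fun ξ ↦ (Circle.norm_coe _).le)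
  simp only [fourierInv_add_right P _ y]
  rw [integral_fourierInv_mul_eq hPy hl, Real.fourierInv_eq]
  congr 1 with ξ
  simp only [← hPl, Circle.smul_def, smul_eq_mul, RCLike.inner_apply, conj_trivial, mul_comm ξ]
  ring

theorem integral_fourierInv_mul_convolution {l k P γ : ℝ → ℂ} (hl : Integrable l)
    (hk : Integrable k) (hP : Integrable P) (hγ : Integrable γ)
    (hPl : ∀ ξ, P ξ * 𝓕⁻ l ξ = 𝓕 k ξ) (x₀ : ℝ) :
    ∫ t, 𝓕⁻ P (t - x₀) * ∫ u, γ u * l (t - u) = ∫ u, γ u * k (u - x₀) := by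
  have hprod : Integrable (fun p : ℝ × ℝ ↦ 𝓕⁻ P (p.1 - x₀) * (γ p.2 * l (p.1 - p.2)))
      (volume.prod volume) :=
    (hγ.convolution_integrand (ContinuousLinearMap.mul ℂ ℂ) hl).bdd_mul (c := ∫ v, ‖P v‖)
      ((continuous_fourierInv_of_integrable hP).comp (by fun_prop)).aestronglyMeasurable
      (.of_forall fun p ↦ norm_fourierInv_le_integral_norm P _)
  have hae : ∀ᵐ u : ℝ, ∫ v, 𝓕⁻ P (v + (u - x₀)) * l v = k (u - x₀) :=
    (measurePreserving_sub_right volume x₀).quasiMeasurePreserving.ae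
      (integral_fourierInv_mul_ae_eq hl hk hP hPl)
  calc ∫ t, 𝓕⁻ P (t - x₀) * ∫ u, γ u * l (t - u)
      = ∫ t, ∫ u, 𝓕⁻ P (t - x₀) * (γ u * l (t - u)) := by simp_rw [integral_const_mul]
    _ = ∫ u, ∫ t, 𝓕⁻ P (t - x₀) * (γ u * l (t - u)) := integral_integral_swap hprod
    _ = ∫ u, γ u * k (u - x₀) := by
      refine integral_congr_ae ?_
      filter_upwards [hae] with u hu
      rw [← hu, ← integral_const_mul,
        ← integral_add_right_eq_self (fun t ↦ 𝓕⁻ P (t - x₀) * (γ u * l (t - u))) u]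
      congr 1 with v
      rw [add_sub_cancel_right, add_sub_assoc]
      ring

/-- Lemma 1 of the paper: the deconvolution kernel `L_h` satisfies
`∫₀^∞ L_h(t−x₀) H(t) dt = ∫ (1/h) K((x−x₀)/h) Ḡ(x) dx`. -/
theorem statement1
    (lam G Gbar H : ℝ → ℝ) (K : ℝ → ℝ)
    (hatlam hatK : ℂ → ℂ) (Lh : ℝ → ℂ)
    (σlam h s : ℝ) (hσlam : 0 ≤ σlam) (hh : 0 < h) (hs : s < -σlam)
    (hlam_nonneg : ∀ x, 0 ≤ lam x)
    (hlam_supp : ∀ x < (0:ℝ), lam x = 0)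
    (hlam_loc : LocallyIntegrable lam)
    (hhatlam_int : ∀ z : ℂ, σlam < z.re →
      IntegrableOn (fun t : ℝ => Complex.exp (-(z * (t:ℂ))) * (lam t : ℂ)) (Ioi 0))
    (hhatlam : ∀ z : ℂ, σlam < z.re →
      hatlam z = ∫ t in Ioi (0:ℝ), Complex.exp (-(z * (t:ℂ))) * (lam t : ℂ))
    (hhatlam_ne : ∀ z : ℂ, σlam < z.re → hatlam z ≠ 0)
    (hG_mono : Monotone G) (hG_nonneg : ∀ u, 0 ≤ G u) (hG_le_one : ∀ u, G u ≤ 1)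
    (hG_supp : ∀ u < (0:ℝ), G u = 0)
    (hGbar : ∀ u, Gbar u = 1 - G u)
    (hH : ∀ t, H t = ∫ u in Ioi (0:ℝ), Gbar u * lam (t - u))
    (hK_bdd : ∃ C, ∀ x, |K x| ≤ C)
    (hK_supp : Function.support K ⊆ Icc 0 1)
    (hK_meas : Measurable K)
    (hhatK : ∀ z : ℂ, hatK z = ∫ t in Icc (0:ℝ) 1, Complex.exp (-(z * (t:ℂ))) * (K t : ℂ))
    (hLh : ∀ t : ℝ, Lh t = (Complex.exp ((s:ℂ) * (t:ℂ)) / (2 * (Real.pi : ℂ))) *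
      ∫ ω : ℝ, hatK (((s:ℂ) + Complex.I * (ω:ℂ)) * (h:ℂ)) /
          hatlam (-((s:ℂ) + Complex.I * (ω:ℂ))) *
        Complex.exp (Complex.I * (ω:ℂ) * (t:ℂ)))
    (hint1 : Integrable (fun ω : ℝ =>
      ‖hatK (((s:ℂ) + Complex.I * (ω:ℂ)) * (h:ℂ)) / hatlam (-((s:ℂ) + Complex.I * (ω:ℂ)))‖))
    (hint2 : ∀ x₀ : ℝ, IntegrableOn (fun t => ‖Lh (t - x₀)‖ * H t) (Ioi 0)) :
    ∀ x₀ : ℝ, 0 < x₀ →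
      ∫ t in Ioi (0:ℝ), Lh (t - x₀) * (H t : ℂ)
        = ((∫ x : ℝ, (1 / h) * K ((x - x₀) / h) * Gbar x : ℝ) : ℂ) := by
  intro x₀ hx₀
  set l : ℝ → ℂ := fun v ↦ Complex.exp (s * v) * lam v with hl_def
  set k : ℝ → ℂ := fun y ↦ Complex.exp (-(s * y)) * K (y / h) / h with hk_def
  set γ : ℝ → ℂ := (Ioi 0).indicator fun u ↦ Complex.exp (s * u) * Gbar u with hγ_def
  set w : ℝ → ℂ := fun ξ ↦ s + Complex.I * ((2 * Real.pi * ξ : ℝ) : ℂ) with hw_def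
  set P : ℝ → ℂ := fun ξ ↦ hatK (w ξ * h) / hatlam (-w ξ) with hP_def
  have hw_re (ξ : ℝ) : σlam < (-w ξ).re := by
    simp [hw_def]; linarith
  have hl : Integrable l := by
    have h1 : IntegrableOn l (Ioi 0) := by
      refine (hhatlam_int (-s) (by simp; linarith)).congr_fun (fun t _ ↦ ?_) measurableSet_Ioi
      simp [hl_def]
    refine (integrableOn_iff_integrable_of_support_subset (s := Ici 0) fun t ht ↦ ?_).1
      ((integrableOn_Ici_iff_integrableOn_Ioi (by finiteness)).2 h1)
    by_contra hlt
    exact ht (by simp [hl_def, hlam_supp t (by simpa using hlt)])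
  have hk : Integrable k := by
    obtain ⟨C, hC⟩ := hK_bdd
    have hK_int : IntegrableOn (fun t : ℝ ↦ Complex.exp (-(s * (h * t))) * K t / h) (Icc 0 1) := by
      have h1 : IntegrableOn (fun t : ℝ ↦ Complex.exp (-(s * (h * t))) / h) (Icc 0 1) :=
        Continuous.integrableOn_Icc (by fun_prop)
      refine (h1.mul_bdd (c := C) (g := fun t ↦ (K t : ℂ))
        (by fun_prop) (.of_forall fun t ↦ by simpa using hC t)).congr (.of_forall fun t ↦ ?_)
      simp only
      ring
    have h2 := (integrableOn_iff_integrable_of_support_subset fun t ht ↦ hK_supp fun hKt ↦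
      ht (by simp [hKt])).1 hK_int
    refine (h2.comp_div hh.ne').congr (.of_forall fun y ↦ ?_)
    have : (h : ℂ) ≠ 0 := by exact_mod_cast hh.ne'
    simp [hk_def, mul_div_cancel₀ _ this]
  have hGbar_meas : Measurable Gbar := by
    rw [funext hGbar]
    exact measurable_const.sub hG_mono.measurable
  have hγ : Integrable γ := by
    refine IntegrableOn.integrable_indicator ?_ measurableSet_Ioi
    refine (integrableOn_exp_mul_complex_Ioi (a := s) (by simp; linarith) 0).mul_bdd (c := 1)
      (by fun_prop) (.of_forall fun u ↦ ?_)
    rw [Complex.norm_real, Real.norm_eq_abs, hGbar, abs_le]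
    constructor <;> linarith [hG_nonneg u, hG_le_one u]
  have hl_fourier (ξ : ℝ) : 𝓕⁻ l ξ = hatlam (-w ξ) := by
    rw [hhatlam _ (hw_re ξ), Real.fourierInv_eq', ← integral_Ici_eq_integral_Ioi,
      setIntegral_eq_integral_of_forall_compl_eq_zero]
    · congr 1 with t
      rw [hl_def, smul_eq_mul, ← mul_assoc, ← Complex.exp_add]
      congr 2
      simp [hw_def]
      ring
    · intro t ht
      simp [hlam_supp t (by simpa using ht)]
  have hk_fourier (ξ : ℝ) : 𝓕 k ξ = hatK (w ξ * h) := by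
    have hh' : (h : ℂ) ≠ 0 := by exact_mod_cast hh.ne'
    rw [hhatK, Real.fourier_eq', setIntegral_eq_integral_of_forall_compl_eq_zero]
    · have := Measure.integral_comp_div
        (fun t : ℝ ↦ Complex.exp (-(w ξ * h * t)) * (K t : ℂ)) h
      rw [abs_of_pos hh, Complex.real_smul] at this
      rw [← mul_right_inj' hh', ← this, ← integral_const_mul]
      congr 1 with y
      have hexp : Complex.exp (-(w ξ * h * ((y / h : ℝ) : ℂ))) =
          Complex.exp (((-2 * Real.pi * inner ℝ y ξ : ℝ) : ℂ) * Complex.I) *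
            Complex.exp (-(s * y)) := by
        rw [← Complex.exp_add]
        congr 1
        simp [hw_def]
        field_simp
        ring
      rw [hexp]
      simp only [hk_def, smul_eq_mul]
      field_simp
    · intro t ht
      simp [Function.notMem_support.1 fun hmem ↦ ht (hK_supp hmem)]
  have hP : Integrable P := by
    refine (integrable_norm_iff ?_).1 ?_
    · simp_rw [hP_def, ← hk_fourier, ← hl_fourier]
      exact (((continuous_fourier_of_integrable hk).measurable).div
        (continuous_fourierInv_of_integrable hl).measurable).aestronglyMeasurable
    · exact hint1.comp_mul_left' (R := 2 * Real.pi) (by positivity)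
  have hPl (ξ : ℝ) : P ξ * 𝓕⁻ l ξ = 𝓕 k ξ := by
    rw [hl_fourier, hk_fourier, hP_def]
    exact div_mul_cancel₀ _ (hhatlam_ne _ (hw_re ξ))
  have hLh' (t : ℝ) : Lh t = Complex.exp (s * t) * 𝓕⁻ P t := by
    have hpi : (2 * Real.pi : ℂ) ≠ 0 := by simp [Real.pi_ne_zero]
    have := Measure.integral_comp_mul_left (fun ω : ℝ ↦
      hatK (((s:ℂ) + Complex.I * (ω:ℂ)) * (h:ℂ)) / hatlam (-((s:ℂ) + Complex.I * (ω:ℂ))) *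
        Complex.exp (Complex.I * (ω:ℂ) * (t:ℂ))) (2 * Real.pi)
    rw [abs_of_pos (by positivity), Complex.real_smul] at this
    rw [hLh, div_mul_eq_mul_div, mul_div_assoc, div_eq_inv_mul, Real.fourierInv_eq']
    congr 1
    push_cast at this
    rw [← this]
    congr 1 with ξ
    simp only [hP_def, hw_def, smul_eq_mul, RCLike.inner_apply, conj_trivial]
    push_cast
    rw [mul_comm]
    congr 2
    ring
  have hH_zero (t : ℝ) (ht : t ∉ Ioi (0 : ℝ)) : H t = 0 := by
    rw [hH]
    refine setIntegral_eq_zero_of_forall_eq_zero fun u hu ↦ ?_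
    rw [hlam_supp _ (by simp only [mem_Ioi, not_lt] at ht hu; linarith), mul_zero]
  have hconv (t : ℝ) : Complex.exp (s * t) * H t = ∫ u, γ u * l (t - u) := by
    rw [hH, ← integral_complex_ofReal, ← integral_const_mul, ← integral_indicator measurableSet_Ioi]
    congr 1 with u
    by_cases hu : u ∈ Ioi (0 : ℝ)
    · rw [hγ_def, indicator_of_mem hu, indicator_of_mem hu, hl_def]
      have : Complex.exp (s * t) = Complex.exp (s * u) * Complex.exp (s * (t - u : ℝ)) := by
        rw [← Complex.exp_add]
        push_cast
        ring_nf
      rw [this]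
      push_cast
      ring
    · simp [hγ_def, hu]
  calc ∫ t in Ioi (0:ℝ), Lh (t - x₀) * (H t : ℂ)
      = ∫ t, Lh (t - x₀) * (H t : ℂ) :=
        setIntegral_eq_integral_of_forall_compl_eq_zero fun t ht ↦ by simp [hH_zero t ht]
    _ = ∫ t, Complex.exp (-(s * x₀)) * (𝓕⁻ P (t - x₀) * ∫ u, γ u * l (t - u)) := by
      congr 1 with t
      have : Complex.exp (s * (t - x₀ : ℝ)) =
          Complex.exp (-(s * x₀)) * Complex.exp (s * t) := by
        rw [← Complex.exp_add]
        push_cast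
        ring_nf
      rw [← hconv, hLh', this]
      ring
    _ = ∫ u, Complex.exp (-(s * x₀)) * (γ u * k (u - x₀)) := by
      rw [integral_const_mul, integral_const_mul,
        integral_fourierInv_mul_convolution hl hk hP hγ hPl]
    _ = ∫ x : ℝ, (((1 / h) * K ((x - x₀) / h) * Gbar x : ℝ) : ℂ) := by
      congr 1 with u
      by_cases hu : u ∈ Ioi (0 : ℝ)
      · rw [hγ_def, indicator_of_mem hu, hk_def]
        have : Complex.exp (-(s * x₀)) * Complex.exp (s * u) *
            Complex.exp (-(s * (u - x₀ : ℝ))) = 1 := by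
          rw [← Complex.exp_add, ← Complex.exp_add, Complex.exp_eq_one_iff]
          exact ⟨0, by push_cast; ring⟩
        push_cast at this ⊢
        linear_combination (K ((u - x₀) / h) / h * Gbar u : ℂ) * this
      · have hK0 : K ((u - x₀) / h) = 0 := by
          refine Function.notMem_support.1 fun hmem ↦ ?_
          have h1 := (hK_supp hmem).1
          rw [le_div_iff₀ hh] at h1
          simp only [mem_Ioi, not_lt] at hu
          linarith
        simp [hγ_def, hu, hK0]
    _ = _ := integral_complex_ofReal
end

section
/- Let λ : ℝ → [0,∞) be locally integrable, supported on [0,∞), whose Laplace transform λ̂(z) = ∫₀^∞ e^{−zt} λ(t) dt converges absolutely for Re(z) > σ_λ (σ_λ ≥ 0) and has no zeros there. Let G be a distribution function supported on [0,∞) with Ḡ = 1 − G, and set H(t) = ∫₀^∞ Ḡ(u) λ(t−u) du. Let b > 1/4 and let ψ_b : ℝ → [0,1] be an infinitely differentiable function with ψ_b(t) = 1 for t ∈ [0,b] and ψ_b(t) = 0 for t ∉ [−1/4, b+1/4]; its Laplace transform ψ̂_b is entire. For fixed s < −σ_λ define J_b(t) := (1/(2π)) ∫_{−∞}^{∞}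 [ψ̂_b(s+iω)/λ̂(−s−iω)] e^{(s+iω)t} dω. If ∫_{−∞}^{∞} |ψ̂_b(s+iω)/λ̂(−s−iω)| dω < ∞ and ∫₀^∞ |J_b(t)| H(t) dt < ∞, then ∫₀^∞ J_b(t) H(t) dt = ∫₀^∞ ψ_b(x) Ḡ(x) dx. -/
open MeasureTheory Set

/-- An oscillatory integral of an integrable function is continuous in the frequency. -/
lemma continuous_integral_cexp_mul {f : ℝ → ℂ} (hf : Integrable f) :
    Continuous fun ω : ℝ => ∫ t : ℝ, Complex.exp (Complex.I * ω * t) * f t := by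
  have hn : ∀ ω t : ℝ, ‖Complex.exp (Complex.I * ω * t)‖ = 1 := fun ω t => by
    rw [show Complex.I * ω * t = ((ω * t : ℝ) : ℂ) * Complex.I by push_cast; ring]
    exact Complex.norm_exp_ofReal_mul_I _
  refine continuous_of_dominated (bound := fun t => ‖f t‖) (fun ω => ?_) (fun ω => ?_) hf.norm ?_
  · exact (Continuous.aestronglyMeasurable (by fun_prop)).mul hf.aestronglyMeasurable
  · exact Filter.Eventually.of_forall fun t => by rw [norm_mul, hn, one_mul]
  · exact Filter.Eventually.of_forall fun t => by fun_prop

lemma norm_integral_cexp_mul_le (f : ℝ → ℂ) (ω : ℝ) :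
    ‖∫ t : ℝ, Complex.exp (Complex.I * ω * t) * f t‖ ≤ ∫ t, ‖f t‖ := by
  refine (norm_integral_le_integral_norm _).trans (le_of_eq ?_)
  congr 1 with t
  rw [show Complex.I * ω * t = ((ω * t : ℝ) : ℂ) * Complex.I by push_cast; ring, norm_mul,
    Complex.norm_exp_ofReal_mul_I, one_mul]

/-- Fourier inversion in the angular-frequency normalisation. -/
lemma integral_cexp_mul_fourier {f F : ℝ → ℂ} (hc : Continuous f) (hf : Integrable f)
    (hF : ∀ ω : ℝ, F ω = ∫ t : ℝ, Complex.exp (-(Complex.I * ω * t)) * f t)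
    (hFi : Integrable F) (u : ℝ) :
    ∫ ω : ℝ, F ω * Complex.exp (Complex.I * ω * u) = 2 * Real.pi * f u := by
  have hpi : (2 * Real.pi : ℝ) ≠ 0 := by positivity
  have hE : FourierTransform.fourier f = fun ξ : ℝ => F (2 * Real.pi * ξ) := by
    ext ξ
    rw [Real.fourier_real_eq_integral_exp_smul, hF]
    congr 1 with t
    rw [smul_eq_mul]
    congr 2
    push_cast
    ring
  have h := congrFun (hc.fourierInv_fourier_eq hf (by rw [hE]; exact hFi.comp_mul_left' hpi)) u
  rw [Real.fourierInv_eq', hE] at h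
  have h2 := Measure.integral_comp_mul_left
    (fun ω : ℝ => F ω * Complex.exp (Complex.I * ω * u)) (2 * Real.pi)
  have h3 : (∫ x : ℝ, F (2 * Real.pi * x) *
      Complex.exp (Complex.I * ((2 * Real.pi * x : ℝ) : ℂ) * u)) = f u := by
    rw [← h]
    congr 1 with x
    rw [smul_eq_mul, mul_comm]
    congr 2
    simp only [RCLike.inner_apply, conj_trivial]
    push_cast
    ring
  rw [h3, abs_of_pos (by positivity)] at h2
  rw [h2, Complex.real_smul, ← mul_assoc, ← Complex.ofReal_ofNat, ← Complex.ofReal_mul,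
    ← Complex.ofReal_mul, mul_inv_cancel₀ hpi, Complex.ofReal_one, one_mul]

/-- Pairing the inverse transform of `q` with a translate of `e`. -/
lemma integral_invFourier_mul_translate {q e : ℝ → ℂ} (hq : Integrable q) (he : Integrable e)
    (u : ℝ) :
    ∫ t : ℝ, (∫ ω : ℝ, q ω * Complex.exp (Complex.I * ω * t)) * e (t - u) =
      ∫ ω : ℝ, q ω * Complex.exp (Complex.I * ω * u) *
        ∫ t : ℝ, Complex.exp (Complex.I * ω * t) * e t := by
  have hint : Integrable (Function.uncurry fun t ω : ℝ =>
      Complex.exp (Complex.I * ω * t) * (e (t - u) * q ω)) (volume.prod volume) := by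
    refine ((he.comp_sub_right u).mul_prod hq).bdd_mul (c := 1)
      (Continuous.aestronglyMeasurable (by fun_prop)) (Filter.Eventually.of_forall fun x => ?_)
    rw [show Complex.I * (x.2 : ℂ) * (x.1 : ℂ) = ((x.2 * x.1 : ℝ) : ℂ) * Complex.I by
      push_cast; ring, Complex.norm_exp_ofReal_mul_I]
  have hsw := integral_integral_swap hint
  calc _ = ∫ t : ℝ, ∫ ω : ℝ, Complex.exp (Complex.I * ω * t) * (e (t - u) * q ω) := by
        congr 1 with t
        rw [← integral_mul_const]
        congr 1 with ω
        ring
    _ = _ := by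
        rw [hsw]
        congr 1 with ω
        rw [← integral_const_mul, ← integral_sub_right_eq_self
          (fun t : ℝ => q ω * Complex.exp (Complex.I * ω * u) *
            (Complex.exp (Complex.I * ω * t) * e t)) u]
        congr 1 with t
        push_cast
        rw [mul_sub, Complex.exp_sub]
        field_simp [Complex.exp_ne_zero]

/-- Lemma 2 of the paper: `∫₀^∞ J_b(t) H(t) dt = ∫₀^∞ ψ_b(x) Ḡ(x) dx`. -/
theorem statement3
    (lam G Gbar H : ℝ → ℝ) (ψb : ℝ → ℝ)
    (hatlam hatψb : ℂ → ℂ) (Jb : ℝ → ℂ)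
    (σlam b s : ℝ) (hσlam : 0 ≤ σlam) (hb : 1/4 < b) (hs : s < -σlam)
    (hlam_nonneg : ∀ x, 0 ≤ lam x)
    (hlam_supp : ∀ x < (0:ℝ), lam x = 0)
    (hlam_loc : LocallyIntegrable lam)
    (hhatlam_int : ∀ z : ℂ, σlam < z.re →
      IntegrableOn (fun t : ℝ => Complex.exp (-(z * (t:ℂ))) * (lam t : ℂ)) (Ioi 0))
    (hhatlam : ∀ z : ℂ, σlam < z.re →
      hatlam z = ∫ t in Ioi (0:ℝ), Complex.exp (-(z * (t:ℂ))) * (lam t : ℂ))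
    (hhatlam_ne : ∀ z : ℂ, σlam < z.re → hatlam z ≠ 0)
    (hG_mono : Monotone G) (hG_nonneg : ∀ u, 0 ≤ G u) (hG_le_one : ∀ u, G u ≤ 1)
    (hG_supp : ∀ u < (0:ℝ), G u = 0)
    (hGbar : ∀ u, Gbar u = 1 - G u)
    (hH : ∀ t, H t = ∫ u in Ioi (0:ℝ), Gbar u * lam (t - u))
    (hψ_smooth : ContDiff ℝ (⊤ : ℕ∞) ψb)
    (hψ_range : ∀ t, ψb t ∈ Icc (0:ℝ) 1)
    (hψ_one : ∀ t ∈ Icc (0:ℝ) b, ψb t = 1)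
    (hψ_zero : ∀ t ∉ Icc (-(1/4):ℝ) (b + 1/4), ψb t = 0)
    (hhatψb : ∀ z : ℂ, hatψb z = ∫ t : ℝ, Complex.exp (-(z * (t:ℂ))) * (ψb t : ℂ))
    (hJb : ∀ t : ℝ, Jb t = (1 / (2 * (Real.pi : ℂ))) *
      ∫ ω : ℝ, hatψb ((s:ℂ) + Complex.I * (ω:ℂ)) /
          hatlam (-((s:ℂ) + Complex.I * (ω:ℂ))) *
        Complex.exp (((s:ℂ) + Complex.I * (ω:ℂ)) * (t:ℂ)))
    (hint1 : Integrable (fun ω : ℝ =>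
      ‖hatψb ((s:ℂ) + Complex.I * (ω:ℂ)) / hatlam (-((s:ℂ) + Complex.I * (ω:ℂ)))‖))
    (hint2 : IntegrableOn (fun t => ‖Jb t‖ * H t) (Ioi 0)) :
    ∫ t in Ioi (0:ℝ), Jb t * (H t : ℂ)
      = ((∫ x in Ioi (0:ℝ), ψb x * Gbar x : ℝ) : ℂ) := by
  have hGbar0 : ∀ u, 0 ≤ Gbar u := fun u => by rw [hGbar]; linarith [hG_le_one u]
  have hGbar1 : ∀ u, Gbar u ≤ 1 := fun u => by rw [hGbar]; linarith [hG_nonneg u]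
  have hGbarm : Measurable Gbar := by
    rw [show Gbar = fun u => 1 - G u from funext hGbar]
    exact measurable_const.sub hG_mono.measurable
  have hre : ∀ ω : ℝ, σlam < (-((s:ℂ) + Complex.I * (ω:ℂ))).re := fun ω => by
    simp; linarith
  set e : ℝ → ℂ := fun t => Complex.exp (s * t) * lam t
  set p : ℝ → ℂ := fun t => Complex.exp (-(s * t)) * ψb t
  have he0 : ∀ t < (0:ℝ), e t = 0 := fun t ht => by simp [e, hlam_supp t ht]
  have he : Integrable e := by
    have h := hhatlam_int (-(s:ℂ)) (by simp; linarith)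
    have h' : IntegrableOn e (Ici 0) := by
      rw [integrableOn_Ici_iff_integrableOn_Ioi]
      refine h.congr_fun (fun t _ => ?_) measurableSet_Ioi
      simp [e]
    refine (integrableOn_iff_integrable_of_support_subset fun t ht => ?_).1 h'
    by_contra hn
    exact ht (he0 t (by simpa using hn))
  have hψc : Continuous ψb := hψ_smooth.continuous
  have hpc : Continuous p := by fun_prop
  have hp : Integrable p := by
    refine hpc.integrable_of_hasCompactSupport
      (HasCompactSupport.intro (isCompact_Icc (a := (-(1/4):ℝ)) (b := b + 1/4)) fun t ht => ?_)
    simp [p, hψ_zero t ht]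
  set A : ℝ → ℂ := fun ω => hatψb ((s:ℂ) + Complex.I * (ω:ℂ))
  set L : ℝ → ℂ := fun ω => hatlam (-((s:ℂ) + Complex.I * (ω:ℂ)))
  have hA : ∀ ω : ℝ, A ω = ∫ t : ℝ, Complex.exp (-(Complex.I * ω * t)) * p t := fun ω => by
    simp only [A, hhatψb, p]
    congr 1 with t
    rw [← mul_assoc, ← Complex.exp_add]
    congr 2
    ring
  have hL : ∀ ω : ℝ, L ω = ∫ t : ℝ, Complex.exp (Complex.I * ω * t) * e t := fun ω => by
    simp only [L]
    rw [hhatlam _ (hre ω), ← integral_Ici_eq_integral_Ioi,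
      ← setIntegral_eq_integral_of_forall_compl_eq_zero (s := Ici (0:ℝ))
        (f := fun t : ℝ => Complex.exp (Complex.I * ω * t) * e t)
        (fun t ht => by rw [he0 t (by simpa using ht), mul_zero])]
    congr 1 with t
    simp only [e]
    rw [← mul_assoc, ← Complex.exp_add]
    congr 2
    ring
  have hLne : ∀ ω, L ω ≠ 0 := fun ω => hhatlam_ne _ (hre ω)
  have hLc : Continuous L := by
    rw [show L = _ from funext hL]; exact continuous_integral_cexp_mul he
  have hAc : Continuous A := by
    have h := (continuous_integral_cexp_mul hp).comp continuous_neg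
    convert h using 1
    ext ω
    rw [hA]
    simp
  set q : ℝ → ℂ := fun ω => A ω / L ω
  have hqc : Continuous q := hAc.div hLc hLne
  have hq : Integrable q := (integrable_norm_iff hqc.aestronglyMeasurable).1 hint1
  have hAi : Integrable A := by
    have h := hq.bdd_mul (c := ∫ t, ‖e t‖) hLc.aestronglyMeasurable
      (Filter.Eventually.of_forall fun ω => by
        rw [hL]; exact norm_integral_cexp_mul_le e ω)
    refine h.congr (Filter.Eventually.of_forall fun ω => ?_)
    simp only [q]
    field_simp [hLne ω]
  set K : ℝ → ℂ := fun t => ∫ ω : ℝ, q ω * Complex.exp (Complex.I * ω * t)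
  have hKc : Continuous K := by
    convert continuous_integral_cexp_mul hq using 1
    ext t
    simp only [K]
    congr 1 with ω
    rw [mul_comm, mul_right_comm]
  have hJK : ∀ t, Jb t = 1 / (2 * (Real.pi : ℂ)) * (Complex.exp (s * t) * K t) := fun t => by
    rw [hJb]
    congr 1
    simp only [K]
    rw [← integral_const_mul]
    congr 1 with ω
    rw [add_mul, Complex.exp_add]
    simp only [q, A, L]
    ring
  have hJc : Continuous Jb := by rw [funext hJK]; fun_prop
  have hrepr : ∀ u, 0 < u → ∫ t in Ioi (0:ℝ), Jb t * (lam (t - u) : ℂ) = ψb u := by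
    intro u hu
    rw [setIntegral_eq_integral_of_forall_compl_eq_zero fun t ht => by
      rw [hlam_supp (t - u) (by simp at ht; linarith)]; simp]
    have h1 : ∀ t : ℝ, Jb t * (lam (t - u) : ℂ) =
        1 / (2 * (Real.pi : ℂ)) * Complex.exp (s * u) * (K t * e (t - u)) := fun t => by
      rw [hJK]
      simp only [e]
      push_cast
      rw [mul_sub, Complex.exp_sub]
      field_simp [Complex.exp_ne_zero]
    simp_rw [h1]
    rw [integral_const_mul, integral_invFourier_mul_translate hq he]
    have h2 : ∀ ω : ℝ, q ω * Complex.exp (Complex.I * ω * u) *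
        ∫ t : ℝ, Complex.exp (Complex.I * ω * t) * e t =
          A ω * Complex.exp (Complex.I * ω * u) := fun ω => by
      rw [← hL]
      simp only [q]
      field_simp [hLne ω]
    simp_rw [h2]
    rw [integral_cexp_mul_fourier hpc hp hA hAi]
    simp only [p]
    rw [Complex.exp_neg]
    have : (Real.pi : ℂ) ≠ 0 := by exact_mod_cast Real.pi_ne_zero
    field_simp [Complex.exp_ne_zero]
  have hinner : ∀ t : ℝ, IntegrableOn (fun u => Gbar u * lam (t - u)) (Ioi 0) := by
    intro t
    have h1 : Integrable fun u : ℝ => Real.exp (s * (t - u)) * lam (t - u) := by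
      refine ((he.norm).comp_sub_left t).congr (Filter.Eventually.of_forall fun u => ?_)
      simp [e, Complex.norm_exp, abs_of_nonneg (hlam_nonneg _)]
    have h2 := (h1.integrableOn (s := Ioi 0)).bdd_mul (c := Real.exp (-(s * t)))
      (f := fun u => Gbar u * Real.exp (-(s * (t - u))))
      (hGbarm.mul (by fun_prop)).aestronglyMeasurable
      ((ae_restrict_mem measurableSet_Ioi).mono fun u hu => by
        rw [norm_mul, Real.norm_of_nonneg (hGbar0 u), Real.norm_of_nonneg (Real.exp_pos _).le]
        refine (mul_le_of_le_one_left (Real.exp_pos _).le (hGbar1 u)).trans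
          (Real.exp_le_exp.2 ?_)
        have : s * u ≤ 0 := mul_nonpos_of_nonpos_of_nonneg (by linarith) (mem_Ioi.1 hu).le
        linarith)
    refine h2.congr (Filter.Eventually.of_forall fun u => ?_)
    simp only
    rw [Real.exp_neg]
    field_simp
  have hmeas : AEStronglyMeasurable (Function.uncurry fun t u : ℝ =>
      Jb t * ((Gbar u * lam (t - u) : ℝ) : ℂ))
      ((volume.restrict (Ioi 0)).prod (volume.restrict (Ioi 0))) := by
    rw [Measure.prod_restrict]
    refine AEStronglyMeasurable.restrict ?_
    have hl : AEStronglyMeasurable (fun x : ℝ × ℝ => lam (x.1 - x.2))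
        (volume.prod volume) :=
      hlam_loc.aestronglyMeasurable.comp_quasiMeasurePreserving
        (quasiMeasurePreserving_sub_of_right_invariant volume volume)
    exact (hJc.comp continuous_fst).aestronglyMeasurable.mul
      (Complex.continuous_ofReal.comp_aestronglyMeasurable
        ((hGbarm.comp measurable_snd).aestronglyMeasurable.mul hl))
  have hprod : Integrable (Function.uncurry fun t u : ℝ =>
      Jb t * ((Gbar u * lam (t - u) : ℝ) : ℂ))
      ((volume.restrict (Ioi 0)).prod (volume.restrict (Ioi 0))) := by
    rw [integrable_prod_iff hmeas]
    refine ⟨Filter.Eventually.of_forall fun t => (hinner t).ofReal.const_mul (Jb t), ?_⟩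
    refine hint2.congr (Filter.Eventually.of_forall fun t => ?_)
    simp only [Function.uncurry_apply_pair]
    rw [hH, ← integral_const_mul]
    congr 1 with u
    rw [norm_mul, Complex.norm_real,
      Real.norm_of_nonneg (mul_nonneg (hGbar0 u) (hlam_nonneg _))]
  calc _ = ∫ t in Ioi (0:ℝ), ∫ u in Ioi (0:ℝ), Jb t * ((Gbar u * lam (t - u) : ℝ) : ℂ) := by
        congr 1 with t
        rw [integral_const_mul, hH, integral_complex_ofReal]
    _ = ∫ u in Ioi (0:ℝ), ∫ t in Ioi (0:ℝ), Jb t * ((Gbar u * lam (t - u) : ℝ) : ℂ) :=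
        integral_integral_swap hprod
    _ = ∫ u in Ioi (0:ℝ), ((ψb u * Gbar u : ℝ) : ℂ) := by
        refine setIntegral_congr_fun measurableSet_Ioi fun u hu => ?_
        rw [Complex.ofReal_mul, ← hrepr u hu, ← integral_mul_const]
        congr 1 with t
        push_cast
        ring
    _ = _ := integral_complex_ofReal
end

section
/- Let G be a distribution function supported on [0,∞) with Ḡ = 1 − G satisfying max_{k=1,2} ∫₀^∞ k t^{k−1} Ḡ(t) dt ≤ M for some M ≥ 0. Let λ : ℝ → [0,∞) vanish on (−∞,0) and satisfy λ(t) ≤ λ₀ e^{σ_λ t} for all t ≥ 0, where λ₀ > 0 and σ_λ > 0. Define, for t, τ ≥ 0, R(t,τ) := ∫_{(t∨τ)−(t∧τ)}^{t∨τ} Ḡ(u) λ((t∨τ)−u) du (so R(t,τ) = ∫_{τ−t}^{τ} Ḡ(u)λ(τ−u)du for τ ≥ t, extended symmetrically). Then for every ν ≥ 0 and every t ≥ 0: ∫₀^∞ R(t,τ) dτ ≤ 2 M λ₀ e^{(σ_λ+ν)t} / (σ_λ + ν). -/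
open MeasureTheory Set

/-- Tonelli for convolutions of nonnegative functions on the line. -/
lemma lintegral_lintegral_mul_sub {f g : ℝ → ENNReal} (hf : Measurable f) (hg : Measurable g) :
    ∫⁻ x, ∫⁻ y, f y * g (x - y) = (∫⁻ y, f y) * ∫⁻ x, g x := by
  rw [lintegral_lintegral_swap (by fun_prop), ← lintegral_mul_const _ hf]
  refine lintegral_congr fun y => ?_
  rw [lintegral_const_mul _ (by fun_prop), lintegral_sub_right_eq_self g y]

lemma lintegral_Iio_ofReal_mul_exp {a c : ℝ} (ha : 0 < a) (hc : 0 ≤ c) (t : ℝ) :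
    ∫⁻ s in Iio t, ENNReal.ofReal (c * Real.exp (a * s)) =
      ENNReal.ofReal (c * (Real.exp (a * t) / a)) := by
  rw [setLIntegral_congr Iio_ae_eq_Iic, ← ofReal_integral_eq_lintegral_ofReal
    ((integrableOn_exp_mul_Iic ha t).const_mul c)
    (Filter.Eventually.of_forall fun s => by positivity),
    integral_const_mul, integral_exp_mul_Iic ha]

/-- Lemma 3(a): covariance tail bound under exponential growth of the arrival rate. -/
theorem statement4
    (G Gbar lam : ℝ → ℝ) (R : ℝ → ℝ → ℝ) (M lam0 σlam : ℝ)
    (hM : 0 ≤ M) (hlam0 : 0 < lam0) (hσ : 0 < σlam)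
    (hG_mono : Monotone G) (hG_nonneg : ∀ u, 0 ≤ G u) (hG_le_one : ∀ u, G u ≤ 1)
    (hG_supp : ∀ u < (0:ℝ), G u = 0)
    (hGbar : ∀ u, Gbar u = 1 - G u)
    (hm1_int : IntegrableOn Gbar (Ioi 0))
    (hm1 : ∫ t in Ioi (0:ℝ), Gbar t ≤ M)
    (hm2_int : IntegrableOn (fun t => 2 * t * Gbar t) (Ioi 0))
    (hm2 : ∫ t in Ioi (0:ℝ), 2 * t * Gbar t ≤ M)
    (hlam_nonneg : ∀ t, 0 ≤ lam t)
    (hlam_supp : ∀ t < (0:ℝ), lam t = 0)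
    (hlam_meas : Measurable lam)
    (hlam_growth : ∀ t, 0 ≤ t → lam t ≤ lam0 * Real.exp (σlam * t))
    (hR : ∀ t τ, R t τ =
      ∫ u in Ioc (max t τ - min t τ) (max t τ), Gbar u * lam (max t τ - u))
    (ν t : ℝ) (hν : 0 ≤ ν) (ht : 0 ≤ t) :
    ∫ τ in Ioi (0:ℝ), R t τ
      ≤ 2 * M * lam0 * Real.exp ((σlam + ν) * t) / (σlam + ν) := by
  have ha : 0 < σlam + ν := by positivity
  have hanti : Antitone Gbar := fun x y h => by
    rw [hGbar, hGbar]; linarith [hG_mono h]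
  have hGbar_nonneg : ∀ u, 0 ≤ Gbar u := fun u => by
    rw [hGbar]; linarith [hG_le_one u]
  have hGbar_meas : Measurable Gbar := hanti.measurable
  set e : ℝ → ENNReal :=
    (Iio t).indicator fun s => ENNReal.ofReal (lam0 * Real.exp ((σlam + ν) * s)) with he
  set g : ℝ → ENNReal := (Ioi 0).indicator fun w => ENNReal.ofReal (Gbar w) with hg
  have he_meas : Measurable e := Measurable.indicator (by fun_prop) measurableSet_Iio
  have hg_meas : Measurable g := Measurable.indicator (by fun_prop) measurableSet_Ioi
  have hpoint : ∀ τ, ‖R t τ‖ₑ ≤ ∫⁻ s, e s * g (τ - s) := by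
    intro τ
    rw [hR]
    refine (enorm_integral_le_lintegral_enorm _).trans ?_
    rw [← lintegral_sub_left_eq_self (fun s => e s * g (τ - s)) (max t τ),
      ← lintegral_indicator measurableSet_Ioc]
    refine lintegral_mono (indicator_le fun u hu => ?_)
    have hs0 : 0 ≤ max t τ - u := by linarith [hu.2]
    have hst : max t τ - u < t := by linarith [hu.1, min_le_left t τ]
    have hsτ : 0 < τ - (max t τ - u) := by linarith [hu.1, min_le_right t τ]
    rw [he, hg, indicator_of_mem (mem_Iio.2 hst), indicator_of_mem (mem_Ioi.2 hsτ),
      ← ENNReal.ofReal_mul (by positivity), Real.enorm_eq_ofReal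
        (mul_nonneg (hGbar_nonneg _) (hlam_nonneg _)), mul_comm]
    refine ENNReal.ofReal_le_ofReal (mul_le_mul ?_ ?_ (hGbar_nonneg _) (by positivity))
    · refine (hlam_growth _ hs0).trans ?_
      gcongr
      linarith
    · exact hanti (by linarith [le_max_right t τ])
  have hbound : ‖∫ τ in Ioi (0:ℝ), R t τ‖ₑ ≤
      ENNReal.ofReal (lam0 * (Real.exp ((σlam + ν) * t) / (σlam + ν)) * M) := by
    calc ‖∫ τ in Ioi (0:ℝ), R t τ‖ₑ ≤ ∫⁻ τ in Ioi (0:ℝ), ‖R t τ‖ₑ :=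
          enorm_integral_le_lintegral_enorm _
      _ ≤ ∫⁻ τ, ‖R t τ‖ₑ := setLIntegral_le_lintegral _ _
      _ ≤ ∫⁻ τ, ∫⁻ s, e s * g (τ - s) := lintegral_mono hpoint
      _ = (∫⁻ s, e s) * ∫⁻ w, g w := lintegral_lintegral_mul_sub he_meas hg_meas
      _ ≤ _ := by
        rw [he, hg, lintegral_indicator measurableSet_Iio, lintegral_indicator measurableSet_Ioi,
          lintegral_Iio_ofReal_mul_exp ha hlam0.le, ENNReal.ofReal_mul (q := M) (by positivity),
          ← ofReal_integral_eq_lintegral_ofReal hm1_int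
            (Filter.Eventually.of_forall hGbar_nonneg)]
        gcongr
  have hB : 0 ≤ lam0 * (Real.exp ((σlam + ν) * t) / (σlam + ν)) * M := by positivity
  rw [← ofReal_norm, ENNReal.ofReal_le_ofReal_iff hB] at hbound
  calc _ ≤ _ := Real.le_norm_self _
    _ ≤ _ := hbound
    _ ≤ 2 * (lam0 * (Real.exp ((σlam + ν) * t) / (σlam + ν)) * M) := by linarith
    _ = _ := by ring
end

section
/- Let G be a distribution function supported on [0,∞) with Ḡ = 1 − G satisfying max_{k=1,2} ∫₀^∞ k t^{k−1} Ḡ(t) dt ≤ M for some M ≥ 0. Let λ : ℝ → [0,∞) vanish on (−∞,0) and satisfy λ(t) ≤ λ₀ (a₁ + a₂ t^p) for all t ≥ 0, where λ₀ > 0, p ≥ 0, a₁ ≥ 0, a₂ > 0. Define, for t, τ ≥ 0, R(t,τ) := ∫_{(t∨τ)−(t∧τ)}^{t∨τ} Ḡ(u) λ((t∨τ)−u) du (so R(t,τ) = ∫_{τ−t}^{τ} Ḡ(u)λ(τ−u)du for τ ≥ t, extended symmetrically). Then for every t ≥ 0: ∫₀^∞ R(t,τ) dτ ≤ 3 M λ₀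 (a₁ + a₂ t^p). -/
open MeasureTheory Set

theorem indicator_abs_sub_lt_slice (g : ℝ → ℝ) (t u : ℝ) :
    (fun x : ℝ => {z : ℝ × ℝ | |z.1 - t| < z.2}.indicator (fun z => g z.2) (x, u)) =
      (Metric.ball t u).indicator (fun _ => g u) := by
  ext x
  simp [indicator, Real.dist_eq]

theorem integrable_prod_indicator_ball (g : ℝ → ℝ) (hg : Measurable g)
    (hint : IntegrableOn (fun u => 2 * u * g u) (Ioi 0)) (t : ℝ) :
    Integrable ({z : ℝ × ℝ | |z.1 - t| < z.2}.indicator (fun z => g z.2))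
      (volume.prod (volume.restrict (Ioi 0))) := by
  have hS : MeasurableSet {z : ℝ × ℝ | |z.1 - t| < z.2} :=
    measurableSet_lt (by fun_prop) measurable_snd
  have hmeas : Measurable ({z : ℝ × ℝ | |z.1 - t| < z.2}.indicator (fun z => g z.2)) :=
    (hg.comp measurable_snd).indicator hS
  rw [integrable_prod_iff' hmeas.aestronglyMeasurable]
  refine ⟨Filter.Eventually.of_forall fun u => ?_, ?_⟩
  · simp only [indicator_abs_sub_lt_slice]
    exact (integrableOn_const measure_ball_lt_top.ne).integrable_indicator measurableSet_ball
  · refine (integrable_congr ?_).mp hint.norm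
    filter_upwards [ae_restrict_mem measurableSet_Ioi] with u hu
    have hu' : (0 : ℝ) < u := hu
    have hn : (fun x : ℝ => ‖{z : ℝ × ℝ | |z.1 - t| < z.2}.indicator (fun z => g z.2) (x, u)‖)
        = (Metric.ball t u).indicator (fun _ => ‖g u‖) := by
      ext x
      rw [congrFun (indicator_abs_sub_lt_slice g t u) x, norm_indicator_eq_indicator_norm]
    rw [hn, integral_indicator measurableSet_ball, setIntegral_const,
      Real.volume_real_ball hu'.le, norm_mul, Real.norm_of_nonneg (by positivity), smul_eq_mul]

theorem setIntegral_Ioi_abs_sub_eq (g : ℝ → ℝ) (t x : ℝ) :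
    ∫ u in Ioi (0 : ℝ), {z : ℝ × ℝ | |z.1 - t| < z.2}.indicator (fun z => g z.2) (x, u) =
      ∫ u in Ioi |x - t|, g u := by
  have h : (fun u : ℝ => {z : ℝ × ℝ | |z.1 - t| < z.2}.indicator (fun z => g z.2) (x, u)) =
      (Ioi |x - t|).indicator g := by
    ext u
    simp [indicator]
  rw [h, setIntegral_indicator measurableSet_Ioi,
    inter_eq_right.mpr (Ioi_subset_Ioi (abs_nonneg _))]

theorem integrable_setIntegral_Ioi_abs_sub (g : ℝ → ℝ) (hg : Measurable g)
    (hint : IntegrableOn (fun u => 2 * u * g u) (Ioi 0)) (t : ℝ) :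
    Integrable (fun x : ℝ => ∫ u in Ioi |x - t|, g u) := by
  simpa only [setIntegral_Ioi_abs_sub_eq] using
    (integrable_prod_indicator_ball g hg hint t).integral_prod_left

theorem integral_setIntegral_Ioi_abs_sub (g : ℝ → ℝ) (hg : Measurable g)
    (hint : IntegrableOn (fun u => 2 * u * g u) (Ioi 0)) (t : ℝ) :
    ∫ x : ℝ, ∫ u in Ioi |x - t|, g u = ∫ u in Ioi (0 : ℝ), 2 * u * g u := by
  simp only [← setIntegral_Ioi_abs_sub_eq]
  rw [integral_integral_swap (f := fun x u =>
    {z : ℝ × ℝ | |z.1 - t| < z.2}.indicator (fun z => g z.2) (x, u))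
    (integrable_prod_indicator_ball g hg hint t)]
  refine setIntegral_congr_fun measurableSet_Ioi fun u hu => ?_
  have hu' : (0 : ℝ) < u := hu
  simp only [indicator_abs_sub_lt_slice]
  rw [integral_indicator measurableSet_ball, setIntegral_const, Real.volume_real_ball hu'.le,
    smul_eq_mul]

/-- Lemma 3(b): covariance tail bound under polynomial growth of the arrival rate. -/
theorem statement5
    (G Gbar lam : ℝ → ℝ) (R : ℝ → ℝ → ℝ) (M lam0 p a₁ a₂ : ℝ)
    (hM : 0 ≤ M) (hlam0 : 0 < lam0) (hp : 0 ≤ p) (ha₁ : 0 ≤ a₁) (ha₂ : 0 < a₂)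
    (hG_mono : Monotone G) (hG_nonneg : ∀ u, 0 ≤ G u) (hG_le_one : ∀ u, G u ≤ 1)
    (hG_supp : ∀ u < (0:ℝ), G u = 0)
    (hGbar : ∀ u, Gbar u = 1 - G u)
    (hm1_int : IntegrableOn Gbar (Ioi 0))
    (hm1 : ∫ t in Ioi (0:ℝ), Gbar t ≤ M)
    (hm2_int : IntegrableOn (fun t => 2 * t * Gbar t) (Ioi 0))
    (hm2 : ∫ t in Ioi (0:ℝ), 2 * t * Gbar t ≤ M)
    (hlam_nonneg : ∀ t, 0 ≤ lam t)
    (hlam_supp : ∀ t < (0:ℝ), lam t = 0)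
    (hlam_meas : Measurable lam)
    (hlam_growth : ∀ t, 0 ≤ t → lam t ≤ lam0 * (a₁ + a₂ * t ^ p))
    (hR : ∀ t τ, R t τ =
      ∫ u in Ioc (max t τ - min t τ) (max t τ), Gbar u * lam (max t τ - u))
    (t : ℝ) (ht : 0 ≤ t) :
    ∫ τ in Ioi (0:ℝ), R t τ ≤ 3 * M * lam0 * (a₁ + a₂ * t ^ p) := by
  have hGbar_nonneg : ∀ u, 0 ≤ Gbar u := fun u => by
    rw [hGbar]
    linarith [hG_le_one u]
  have hGbar_meas : Measurable Gbar := by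
    rw [show Gbar = fun u => 1 - G u from funext hGbar]
    exact measurable_const.sub hG_mono.measurable
  set C : ℝ := lam0 * (a₁ + a₂ * t ^ p) with hC
  have hC_nonneg : 0 ≤ C := by positivity
  have hlam_le : ∀ s, 0 ≤ s → s ≤ t → lam s ≤ C := fun s hs hst =>
    (hlam_growth s hs).trans (by rw [hC]; gcongr)
  have hR_nonneg : ∀ τ, 0 ≤ R t τ := fun τ => by
    rw [hR]
    exact integral_nonneg fun u => mul_nonneg (hGbar_nonneg u) (hlam_nonneg _)
  have hR_le : ∀ τ, R t τ ≤ C * ∫ u in Ioi |τ - t|, Gbar u := fun τ => by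
    have hsub : max t τ - min t τ = |τ - t| := max_sub_min_eq_abs t τ
    have hint : IntegrableOn (fun u => C * Gbar u) (Ioi |τ - t|) :=
      (hm1_int.mono_set (Ioi_subset_Ioi (abs_nonneg _))).const_mul C
    rw [hR, hsub, ← integral_const_mul]
    calc ∫ u in Ioc |τ - t| (max t τ), Gbar u * lam (max t τ - u)
        ≤ ∫ u in Ioc |τ - t| (max t τ), C * Gbar u := by
          refine integral_mono_of_nonneg
            (Filter.Eventually.of_forall fun u => mul_nonneg (hGbar_nonneg u) (hlam_nonneg _))
            (hint.mono_set Ioc_subset_Ioi_self) ?_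
          filter_upwards [ae_restrict_mem measurableSet_Ioc] with u hu
          rw [mul_comm]
          refine mul_le_mul_of_nonneg_right (hlam_le _ (sub_nonneg.mpr hu.2) ?_) (hGbar_nonneg u)
          linarith [hu.1, min_le_left t τ]
      _ ≤ ∫ u in Ioi |τ - t|, C * Gbar u :=
          setIntegral_mono_set hint
            (Filter.Eventually.of_forall fun u => mul_nonneg hC_nonneg (hGbar_nonneg u))
            Ioc_subset_Ioi_self.eventuallyLE
  have htail := (integrable_setIntegral_Ioi_abs_sub Gbar hGbar_meas hm2_int t).const_mul C
  calc ∫ τ in Ioi (0:ℝ), R t τ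
      ≤ ∫ τ in Ioi (0:ℝ), C * ∫ u in Ioi |τ - t|, Gbar u :=
        integral_mono_of_nonneg (Filter.Eventually.of_forall hR_nonneg) htail.integrableOn
          (Filter.Eventually.of_forall hR_le)
    _ ≤ ∫ τ, C * ∫ u in Ioi |τ - t|, Gbar u :=
        setIntegral_le_integral htail (Filter.Eventually.of_forall fun τ =>
          mul_nonneg hC_nonneg (integral_nonneg hGbar_nonneg))
    _ = C * ∫ u in Ioi (0:ℝ), 2 * u * Gbar u := by
        rw [integral_const_mul, integral_setIntegral_Ioi_abs_sub Gbar hGbar_meas hm2_int t]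
    _ ≤ C * M := mul_le_mul_of_nonneg_left hm2 hC_nonneg
    _ ≤ 3 * M * lam0 * (a₁ + a₂ * t ^ p) := by
        rw [show 3 * M * lam0 * (a₁ + a₂ * t ^ p) = 3 * (C * M) by rw [hC]; ring]
        linarith [mul_nonneg hC_nonneg hM]
end

section
/- Let λ : [0,∞) → [0,∞) be locally integrable with Laplace transform λ̂(z) = ∫₀^∞ e^{−zt} λ(t) dt converging for Re(z) > σ_λ (σ_λ ≥ 0), having no zeros there, and satisfying |λ̂(σ + iω)| ≥ λ₀ k₀ [(σ−σ_λ)² + ω²]^{−γ/2} for all σ > σ_λ, ω ∈ ℝ, where λ₀ > 0, k₀ > 0, γ ≥ 0. Let r be a positive integer with r > γ + 1 and let K : ℝ → ℝ be supported on [0,1], r times continuously differentiable with |K^{(j)}| ≤ C_K for j = 0,…,r, and K̂(z) = ∫₀^1 e^{−zt}K(t)dt. For 0 < h < 1 and 0 < δ < 1/h, set s = −σ_λ − δ and L_h(t) := (e^{st}/(2π)) ∫_{−∞}^{∞} [K̂((s+iω)h)/λ̂(−s−iω)] e^{iωt} dω. Then there exists a constant C > 0 depending only on γ, r, k₀ and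 C_K such that |L_h(t)| ≤ C e^{−(σ_λ+δ)(t−h)} / (λ₀ h^{γ+1}) for all t ∈ ℝ. -/
open MeasureTheory Set

/-- The derivatives of a `C^r` function vanish at every point that is in the closure of an open set
where the function vanishes. -/
lemma iteratedDeriv_eq_zero_of_mem_closure {K : ℝ → ℝ} {r j : ℕ} {U : Set ℝ} (hU : IsOpen U)
    (hK : ContDiff ℝ (r : ℕ∞) K) (h0 : ∀ x ∈ U, K x = 0) (hj : j ≤ r) {x : ℝ}
    (hx : x ∈ closure U) : iteratedDeriv j K x = 0 := by
  have hc : Continuous (iteratedDeriv j K) := by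
    apply hK.continuous_iteratedDeriv
    exact_mod_cast hj
  have hsub : U ⊆ {y | iteratedDeriv j K y = 0} := fun y hy => by
    have he : K =ᶠ[nhds y] fun _ => 0 := by
      filter_upwards [hU.mem_nhds hy] with w hw using h0 w hw
    have := he.iteratedDeriv_eq j
    simpa [iteratedDeriv_const] using this
  exact closure_minimal hsub (isClosed_eq hc continuous_const) hx

/-- Integration by parts for the finite Laplace transform of a function vanishing at both ends. -/
lemma integral_exp_mul_deriv {f f' : ℝ → ℝ} (hf : ∀ x, HasDerivAt f (f' x) x)
    (hf' : Continuous f') (h0 : f 0 = 0) (h1 : f 1 = 0) (z : ℂ) :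
    ∫ u in Icc (0 : ℝ) 1, Complex.exp (-(z * (u : ℂ))) * (f' u : ℂ) =
      z * ∫ u in Icc (0 : ℝ) 1, Complex.exp (-(z * (u : ℂ))) * (f u : ℂ) := by
  have hexp : ∀ x : ℝ, HasDerivAt (fun u : ℝ => Complex.exp (-(z * (u : ℂ))))
      (Complex.exp (-(z * (x : ℂ))) * (-(z * 1))) x := fun x =>
    (((hasDerivAt_id (x : ℂ)).const_mul z).neg.cexp).comp_ofReal
  have key := intervalIntegral.integral_mul_deriv_eq_deriv_mul (a := 0) (b := 1)
    (fun x _ => hexp x) (fun x _ => (hf x).ofReal_comp)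
    (Continuous.intervalIntegrable (by fun_prop) _ _)
    (Continuous.intervalIntegrable (by fun_prop) _ _)
  rw [integral_Icc_eq_integral_Ioc, integral_Icc_eq_integral_Ioc,
    ← intervalIntegral.integral_of_le zero_le_one, ← intervalIntegral.integral_of_le zero_le_one,
    key, ← intervalIntegral.integral_const_mul, h0, h1]
  simp only [Complex.ofReal_zero, mul_zero, sub_zero, zero_sub]
  rw [← intervalIntegral.integral_neg]
  congr 1
  ext u
  ring

/-- The finite Laplace transform of the `j`-th derivative. -/
lemma integral_exp_mul_iteratedDeriv {K : ℝ → ℝ} {r : ℕ} (hsupp : Function.support K ⊆ Icc 0 1)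
    (hK : ContDiff ℝ (r : ℕ∞) K) (z : ℂ) {j : ℕ} (hj : j ≤ r) :
    ∫ u in Icc (0 : ℝ) 1, Complex.exp (-(z * (u : ℂ))) * ((iteratedDeriv j K u : ℝ) : ℂ) =
      z ^ j * ∫ u in Icc (0 : ℝ) 1, Complex.exp (-(z * (u : ℂ))) * (K u : ℂ) := by
  induction j with
  | zero => simp
  | succ j ih =>
    have hvanish : ∀ x ∉ Icc (0 : ℝ) 1, K x = 0 := fun x hx => by
      by_contra h
      exact hx (hsupp h)
    rw [pow_succ', mul_assoc, ← ih (by omega)]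
    refine integral_exp_mul_deriv (fun x => ?_) ?_ ?_ ?_ z
    · rw [iteratedDeriv_succ]
      refine DifferentiableAt.hasDerivAt ?_
      exact (hK.differentiable_iteratedDeriv j (by exact_mod_cast hj)) x
    · exact hK.continuous_iteratedDeriv _ (by exact_mod_cast hj)
    · refine iteratedDeriv_eq_zero_of_mem_closure (U := Iio 0) isOpen_Iio hK
        (fun x hx => hvanish x fun h => absurd h.1 (not_le.2 hx)) (by omega) ?_
      simp
    · refine iteratedDeriv_eq_zero_of_mem_closure (U := Ioi 1) isOpen_Ioi hK
        (fun x hx => hvanish x fun h => absurd h.2 (not_le.2 hx)) (by omega) ?_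
      simp

lemma norm_integral_exp_mul_le {f : ℝ → ℝ} {C a : ℝ} (hC : 0 ≤ C) (ha : 0 ≤ a)
    (hf : ∀ x ∈ Icc (0 : ℝ) 1, |f x| ≤ C) {z : ℂ} (hz : -a ≤ z.re) :
    ‖∫ u in Icc (0 : ℝ) 1, Complex.exp (-(z * (u : ℂ))) * (f u : ℂ)‖ ≤ C * Real.exp a := by
  have := norm_setIntegral_le_of_norm_le_const (μ := volume) (s := Icc (0 : ℝ) 1)
    (f := fun u : ℝ => Complex.exp (-(z * (u : ℂ))) * (f u : ℂ)) (C := C * Real.exp a)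
    (by simp) (fun u hu => ?_)
  · simpa using this
  · rw [norm_mul, Complex.norm_exp, Complex.norm_real, Real.norm_eq_abs, mul_comm]
    refine mul_le_mul (hf u hu) (Real.exp_le_exp.2 ?_) (Real.exp_pos _).le hC
    simp only [Complex.neg_re, Complex.re_mul_ofReal]
    nlinarith [hu.1, hu.2]

/-- Decay of the finite Laplace transform along vertical lines. -/
lemma norm_integral_exp_mul_le_rpow {K : ℝ → ℝ} {r : ℕ} {C a : ℝ} (hC : 0 ≤ C) (ha : 0 ≤ a)
    (hsupp : Function.support K ⊆ Icc 0 1) (hK : ContDiff ℝ (r : ℕ∞) K)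
    (hb : ∀ j ≤ r, ∀ x ∈ Icc (0 : ℝ) 1, |iteratedDeriv j K x| ≤ C) {z : ℂ} (hz : -a ≤ z.re) :
    ‖∫ u in Icc (0 : ℝ) 1, Complex.exp (-(z * (u : ℂ))) * (K u : ℂ)‖ ≤
      2 ^ ((r : ℝ) / 2) * C * Real.exp a * (1 + z.im ^ 2) ^ (-(r : ℝ) / 2) := by
  have h0 := norm_integral_exp_mul_le hC ha (fun x hx => by simpa using hb 0 r.zero_le x hx) hz
  have hr := norm_integral_exp_mul_le hC ha (hb r le_rfl) hz
  rw [integral_exp_mul_iteratedDeriv hsupp hK z le_rfl, norm_mul, norm_pow] at hr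
  set I := ‖∫ u in Icc (0 : ℝ) 1, Complex.exp (-(z * (u : ℂ))) * (K u : ℂ)‖
  have hI : 0 ≤ I := norm_nonneg _
  have hpos : 0 < 1 + z.im ^ 2 := by positivity
  rw [neg_div, Real.rpow_neg hpos.le, ← div_eq_mul_inv, le_div_iff₀ (by positivity)]
  rcases le_total |z.im| 1 with h | h
  · have h1 : (1 + z.im ^ 2) ^ ((r : ℝ) / 2) ≤ 2 ^ ((r : ℝ) / 2) := by
      refine Real.rpow_le_rpow hpos.le ?_ (by positivity)
      nlinarith [(sq_le_one_iff_abs_le_one z.im).2 h]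
    calc _ ≤ (C * Real.exp a) * 2 ^ ((r : ℝ) / 2) := by gcongr
      _ = _ := by ring
  · have h1 : (1 + z.im ^ 2) ^ ((r : ℝ) / 2) ≤ 2 ^ ((r : ℝ) / 2) * ‖z‖ ^ r := by
      have h2 : (1 + z.im ^ 2) ≤ 2 * ‖z‖ ^ 2 := by
        have h3 := (one_le_sq_iff_one_le_abs z.im).2 h
        have h4 : z.im ^ 2 ≤ ‖z‖ ^ 2 := sq_le_sq' (by
          linarith [neg_abs_le z.im, Complex.abs_im_le_norm z])
          (by linarith [le_abs_self z.im, Complex.abs_im_le_norm z])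
        linarith
      refine (Real.rpow_le_rpow hpos.le h2 (by positivity)).trans_eq ?_
      rw [Real.mul_rpow (by positivity) (by positivity), ← Real.rpow_natCast ‖z‖ 2,
        ← Real.rpow_mul (norm_nonneg _), ← Real.rpow_natCast ‖z‖ r]
      congr 2
      push_cast
      ring
    calc _ ≤ I * (2 ^ ((r : ℝ) / 2) * ‖z‖ ^ r) := by gcongr
      _ = 2 ^ ((r : ℝ) / 2) * (‖z‖ ^ r * I) := by ring
      _ ≤ 2 ^ ((r : ℝ) / 2) * (C * Real.exp a) := by gcongr
      _ = _ := by ring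

/-- Rescaling of the ill-posedness weight to the bandwidth `h`. -/
lemma add_sq_rpow_le {γ h δ ω : ℝ} (hγ : 0 ≤ γ) (hh : 0 < h) (hδ : 0 ≤ δ) (hδh : δ ≤ 1 / h) :
    (δ ^ 2 + ω ^ 2) ^ (γ / 2) ≤ h ^ (-γ) * (1 + (h * ω) ^ 2) ^ (γ / 2) := by
  have h1 : δ ^ 2 + ω ^ 2 ≤ (h ^ 2)⁻¹ * (1 + (h * ω) ^ 2) := by
    have h2 : δ ^ 2 ≤ (1 / h) ^ 2 := by gcongr
    have h3 : (h ^ 2)⁻¹ * (1 + (h * ω) ^ 2) = (1 / h) ^ 2 + ω ^ 2 := by field_simp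
    linarith
  refine (Real.rpow_le_rpow (by positivity) h1 (by positivity)).trans_eq ?_
  rw [Real.mul_rpow (by positivity) (by positivity), Real.inv_rpow (by positivity),
    ← Real.rpow_natCast h 2, ← Real.rpow_mul hh.le, Real.rpow_neg hh.le]
  congr 3
  push_cast
  ring

/-- Pointwise bound on the deconvolution kernel:
`|L_h(t)| ≤ C e^{−(σ_λ+δ)(t−h)} / (λ₀ h^{γ+1})` with `C` depending only on
`γ`, `r`, `k₀` and `C_K`. -/
theorem statement8 (γ k₀ C_K : ℝ) (r : ℕ)
    (hγ : 0 ≤ γ) (hk₀ : 0 < k₀) (hC_K : 0 < C_K) (hr : γ + 1 < r) :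
    ∃ C > 0, ∀ (lam : ℝ → ℝ) (σlam lam0 : ℝ) (hatlam : ℂ → ℂ)
      (K : ℝ → ℝ) (h δ : ℝ) (Lh : ℝ → ℂ),
      0 ≤ σlam → 0 < lam0 →
      (∀ x, 0 ≤ lam x) → (∀ x < (0:ℝ), lam x = 0) → LocallyIntegrable lam →
      (∀ z : ℂ, σlam < z.re →
        IntegrableOn (fun t : ℝ => Complex.exp (-(z * (t:ℂ))) * (lam t : ℂ)) (Ioi 0)) →
      (∀ z : ℂ, σlam < z.re →
        hatlam z = ∫ t in Ioi (0:ℝ), Complex.exp (-(z * (t:ℂ))) * (lam t : ℂ)) →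
      (∀ z : ℂ, σlam < z.re → hatlam z ≠ 0) →
      (∀ σ ω : ℝ, σlam < σ →
        lam0 * k₀ * ((σ - σlam) ^ 2 + ω ^ 2) ^ (-γ / 2)
          ≤ ‖hatlam ((σ:ℂ) + Complex.I * (ω:ℂ))‖) →
      Function.support K ⊆ Icc 0 1 →
      ContDiff ℝ (r : ℕ∞) K →
      (∀ j ≤ r, ∀ x ∈ Icc (0:ℝ) 1, |iteratedDeriv j K x| ≤ C_K) →
      0 < h → h < 1 → 0 < δ → δ < 1 / h →
      (∀ t : ℝ, Lh t = (Complex.exp ((((-σlam - δ) * t : ℝ) : ℂ)) / (2 * (Real.pi : ℂ))) *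
        ∫ ω : ℝ,
          (∫ u in Icc (0:ℝ) 1,
            Complex.exp (-(((((-σlam - δ : ℝ)):ℂ) + Complex.I * (ω:ℂ)) * (h:ℂ) * (u:ℂ))) *
              (K u : ℂ)) /
            hatlam (-((((-σlam - δ : ℝ)):ℂ) + Complex.I * (ω:ℂ))) *
          Complex.exp (Complex.I * (ω:ℂ) * (t:ℂ))) →
      ∀ t : ℝ, ‖Lh t‖ ≤ C * Real.exp (-(σlam + δ) * (t - h)) / (lam0 * h ^ (γ + 1)) := by
  set p : ℝ := r - γ with hp
  set J : ℝ := ∫ x : ℝ, (1 + x ^ 2) ^ (-p / 2) with hJ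
  have hJ0 : 0 ≤ J := integral_nonneg fun x => by positivity
  have hint : Integrable fun x : ℝ => (1 + x ^ 2) ^ (-p / 2) := by
    have := integrable_rpow_neg_one_add_norm_sq (E := ℝ) (μ := volume) (r := p)
      (by simp only [Module.finrank_self]; push_cast; linarith)
    simpa using this
  set B : ℝ := 2 ^ ((r : ℝ) / 2) * C_K / k₀ with hB
  have hB0 : 0 < B := by positivity
  refine ⟨B * (J + 1) / (2 * Real.pi), by positivity, ?_⟩
  intro lam σlam lam0 hatlam K h δ Lh hσ hlam0 _ _ _ _ _ _ hlow hsupp hK hb hh _ hδ hδh hL t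
  set a : ℝ := (σlam + δ) * h with ha
  set A : ℝ := B * Real.exp a / lam0 * h ^ (-γ) with hA
  have hA0 : 0 < A := by positivity
  have hbound : ∀ ω : ℝ, ‖(∫ u in Icc (0:ℝ) 1,
            Complex.exp (-(((((-σlam - δ : ℝ)):ℂ) + Complex.I * (ω:ℂ)) * (h:ℂ) * (u:ℂ))) *
              (K u : ℂ)) /
            hatlam (-((((-σlam - δ : ℝ)):ℂ) + Complex.I * (ω:ℂ))) *
          Complex.exp (Complex.I * (ω:ℂ) * (t:ℂ))‖ ≤ A * (1 + (h * ω) ^ 2) ^ (-p / 2) := by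
    intro ω
    have hnum := norm_integral_exp_mul_le_rpow hC_K.le (a := a) (by positivity) hsupp hK hb
      (z := ((((-σlam - δ : ℝ)):ℂ) + Complex.I * (ω:ℂ)) * (h:ℂ)) (by simp [ha]; linarith)
    have him : (((((-σlam - δ : ℝ)):ℂ) + Complex.I * (ω:ℂ)) * (h:ℂ)).im = h * ω := by
      simp [mul_comm]
    rw [him] at hnum
    have hden := hlow (σlam + δ) (-ω) (by linarith)
    have harg : ((σlam + δ : ℝ) : ℂ) + Complex.I * ((-ω : ℝ) : ℂ) =
        -((((-σlam - δ : ℝ)):ℂ) + Complex.I * (ω:ℂ)) := by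
      push_cast
      ring
    rw [harg, add_sub_cancel_left, neg_sq] at hden
    have hw : 0 < δ ^ 2 + ω ^ 2 := by positivity
    have hexp : ‖Complex.exp (Complex.I * (ω:ℂ) * (t:ℂ))‖ = 1 := by
      rw [Complex.norm_exp]
      simp
    rw [norm_mul, hexp, mul_one, norm_div]
    calc _ ≤ (2 ^ ((r : ℝ) / 2) * C_K * Real.exp a * (1 + (h * ω) ^ 2) ^ (-(r : ℝ) / 2)) /
          (lam0 * k₀ * (δ ^ 2 + ω ^ 2) ^ (-γ / 2)) := by gcongr
      _ = B * Real.exp a / lam0 * (1 + (h * ω) ^ 2) ^ (-(r : ℝ) / 2) *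
          (δ ^ 2 + ω ^ 2) ^ (γ / 2) := by
        rw [neg_div 2 γ, Real.rpow_neg hw.le, hB]
        field_simp
      _ ≤ B * Real.exp a / lam0 * (1 + (h * ω) ^ 2) ^ (-(r : ℝ) / 2) *
          (h ^ (-γ) * (1 + (h * ω) ^ 2) ^ (γ / 2)) := by
        gcongr
        exact add_sq_rpow_le hγ hh hδ.le hδh.le
      _ = A * ((1 + (h * ω) ^ 2) ^ (-(r : ℝ) / 2) * (1 + (h * ω) ^ 2) ^ (γ / 2)) := by
        rw [hA]
        ring
      _ = _ := by
        rw [← Real.rpow_add (by positivity)]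
        congr 2
        rw [hp]
        ring
  have hnorm := norm_integral_le_of_norm_le ((hint.comp_mul_left' hh.ne').const_mul A)
    (Filter.Eventually.of_forall hbound)
  rw [integral_const_mul, Measure.integral_comp_mul_left (fun x : ℝ => (1 + x ^ 2) ^ (-p / 2)) h,
    ← hJ, abs_of_pos (inv_pos.2 hh), smul_eq_mul] at hnorm
  have hpre : ‖Complex.exp ((((-σlam - δ) * t : ℝ) : ℂ)) / (2 * (Real.pi : ℂ))‖ =
      Real.exp ((-σlam - δ) * t) / (2 * Real.pi) := by
    rw [norm_div, Complex.norm_exp, Complex.ofReal_re, norm_mul, Complex.norm_real,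
      Real.norm_of_nonneg Real.pi_pos.le, Complex.norm_ofNat]
  have hsplit : Real.exp (-(σlam + δ) * (t - h)) =
      Real.exp ((-σlam - δ) * t) * Real.exp a := by
    rw [← Real.exp_add, ha]
    ring_nf
  rw [hL t, norm_mul, hpre]
  calc _ ≤ Real.exp ((-σlam - δ) * t) / (2 * Real.pi) * (A * (h⁻¹ * (J + 1))) := by
        gcongr
        exact hnorm.trans (by gcongr; linarith)
    _ = _ := by
      rw [hA, hsplit, Real.rpow_neg hh.le, Real.rpow_add_one hh.ne']
      field_simp
end

section
/- Let γ ≥ 0 and let r be a positive integer with r > γ + 1. Let K : ℝ → ℝ be supported on [0,1], r times continuously differentiable with |K^{(j)}| ≤ C_K for j = 0,…,r, and K̂(z) = ∫₀^1 e^{−zt}K(t)dt. Then there exists a constant c > 0 depending only on γ, r and C_K such that for all 0 < h < 1: ∫_{−∞}^{∞} |K̂(iωh)|² |ω|^{2γ} dω ≤ c h^{−2γ−1}. -/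
open MeasureTheory Set

open FourierTransform in
/-- The Fourier transform of a function supported on `[0, 1]` is bounded by any bound of the
function. -/
theorem norm_fourier_le_of_support_subset_Icc {f : ℝ → ℂ} {C : ℝ}
    (hf : Function.support f ⊆ Icc 0 1) (hC : ∀ x ∈ Icc (0 : ℝ) 1, ‖f x‖ ≤ C) (w : ℝ) :
    ‖𝓕 f w‖ ≤ C := by
  have hint : ∫ t in Icc (0 : ℝ) 1, Complex.exp (↑(-2 * Real.pi * t * w) * Complex.I) • f t =
      𝓕 f w := by
    rw [Real.fourier_real_eq_integral_exp_smul]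
    refine setIntegral_eq_integral_of_forall_compl_eq_zero fun x hx => ?_
    rw [Function.notMem_support.1 fun h => hx (hf h), smul_zero]
  rw [← hint]
  refine (norm_setIntegral_le_of_norm_le_const measure_Icc_lt_top (C := C) fun x hx => ?_).trans
    (by simp)
  rw [norm_smul, Complex.norm_exp_ofReal_mul_I, one_mul]
  exact hC x hx

open FourierTransform in
/-- Decay of the Fourier transform of a `C^r` function supported on `[0, 1]`. -/
theorem pow_mul_norm_fourier_le {f : ℝ → ℂ} {C : ℝ} {r j : ℕ}
    (hf : Function.support f ⊆ Icc 0 1) (hfr : ContDiff ℝ (r : ℕ∞) f)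
    (hC : ∀ j ≤ r, ∀ x ∈ Icc (0 : ℝ) 1, ‖iteratedDeriv j f x‖ ≤ C) (hj : j ≤ r) (w : ℝ) :
    (2 * Real.pi * |w|) ^ j * ‖𝓕 f w‖ ≤ C := by
  have hts : tsupport f ⊆ Icc 0 1 := closure_minimal hf isClosed_Icc
  have hsupp (n : ℕ) : Function.support (iteratedDeriv n f) ⊆ Icc 0 1 := by
    refine Subset.trans (fun x hx => ?_) ((support_iteratedFDeriv_subset (𝕜 := ℝ) n).trans hts)
    rw [Function.mem_support, ← norm_ne_zero_iff] at hx ⊢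
    rwa [norm_iteratedFDeriv_eq_norm_iteratedDeriv]
  have hint (n : ℕ) (hn : (n : ℕ∞) ≤ (r : ℕ∞)) : Integrable (iteratedDeriv n f) :=
    (hfr.continuous_iteratedDeriv n (by exact_mod_cast hn)).integrable_of_hasCompactSupport
      (HasCompactSupport.of_support_subset_isCompact isCompact_Icc (hsupp n))
  have hw := norm_fourier_le_of_support_subset_Icc (hsupp j) (hC j hj) w
  rw [Real.fourier_iteratedDeriv hfr hint (by exact_mod_cast hj)] at hw
  simpa [norm_smul, abs_of_pos Real.pi_pos] using hw

open FourierTransform in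
/-- The Fourier–Laplace transform of a function supported on `[0, 1]` on the imaginary axis is its
Fourier transform, up to normalisation. -/
theorem setIntegral_exp_mul_eq_fourier {f : ℝ → ℂ} (hf : Function.support f ⊆ Icc 0 1)
    (η : ℝ) : ∫ t in Icc (0 : ℝ) 1, Complex.exp (-(Complex.I * (η : ℂ) * (t : ℂ))) * f t =
      𝓕 f (η / (2 * Real.pi)) := by
  rw [Real.fourier_real_eq_integral_exp_smul, setIntegral_eq_integral_of_forall_compl_eq_zero]
  · refine integral_congr_ae (Filter.Eventually.of_forall fun t => ?_)
    simp only [smul_eq_mul]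
    congr 2
    have : (Real.pi : ℂ) ≠ 0 := by exact_mod_cast Real.pi_ne_zero
    push_cast
    field_simp
  · intro x hx
    rw [Function.notMem_support.1 fun h => hx (hf h), mul_zero]

/-- Decay of the Fourier–Laplace transform of a `C^r` function supported on `[0, 1]`. -/
theorem one_add_abs_pow_mul_norm_setIntegral_le {f : ℝ → ℂ} {C : ℝ} {r : ℕ}
    (hf : Function.support f ⊆ Icc 0 1) (hfr : ContDiff ℝ (r : ℕ∞) f)
    (hC : ∀ j ≤ r, ∀ x ∈ Icc (0 : ℝ) 1, ‖iteratedDeriv j f x‖ ≤ C) (η : ℝ) :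
    (1 + |η|) ^ r * ‖∫ t in Icc (0 : ℝ) 1,
      Complex.exp (-(Complex.I * (η : ℂ) * (t : ℂ))) * f t‖ ≤ 2 ^ r * C := by
  rw [setIntegral_exp_mul_eq_fourier hf]
  have hη : 2 * Real.pi * |η / (2 * Real.pi)| = |η| := by
    rw [abs_div, abs_of_pos Real.two_pi_pos]
    exact mul_div_cancel₀ _ Real.two_pi_pos.ne'
  have h0 := pow_mul_norm_fourier_le hf hfr hC (Nat.zero_le r) (η / (2 * Real.pi))
  have h1 := pow_mul_norm_fourier_le hf hfr hC le_rfl (η / (2 * Real.pi))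
  rw [pow_zero, one_mul] at h0
  rw [hη] at h1
  rcases le_total |η| 1 with h | h
  · gcongr
    linarith
  · refine le_trans ?_ (mul_le_mul_of_nonneg_left h1 (by positivity : (0 : ℝ) ≤ 2 ^ r))
    rw [← mul_assoc, ← mul_pow]
    gcongr
    linarith

/-- Conversion of polynomial decay of order `r` into decay of the weighted square. -/
theorem sq_mul_rpow_le_of_one_add_pow_mul_le {γ a b B : ℝ} {r : ℕ} (hγ : 0 ≤ γ) (ha : 0 ≤ a)
    (hb : 0 ≤ b) (h : (1 + a) ^ r * b ≤ B) :
    b ^ 2 * a ^ (2 * γ) ≤ B ^ 2 * (1 + a) ^ (-(2 * (r : ℝ) - 2 * γ)) := by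
  have ha1 : 0 < 1 + a := by linarith
  have hsplit : (1 + a) ^ (2 * γ) =
      ((1 + a) ^ r) ^ 2 * (1 + a) ^ (-(2 * (r : ℝ) - 2 * γ)) := by
    rw [← pow_mul, ← Real.rpow_natCast, ← Real.rpow_add ha1]
    congr 1
    push_cast
    ring
  calc b ^ 2 * a ^ (2 * γ) ≤ b ^ 2 * (1 + a) ^ (2 * γ) := by
        gcongr
        linarith
    _ = ((1 + a) ^ r * b) ^ 2 * (1 + a) ^ (-(2 * (r : ℝ) - 2 * γ)) := by
        rw [hsplit]
        ring
    _ ≤ B ^ 2 * (1 + a) ^ (-(2 * (r : ℝ) - 2 * γ)) := by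
        gcongr

/-- Weighted L² bound on the Fourier–Laplace transform of the kernel:
`∫ |K̂(iωh)|² |ω|^{2γ} dω ≤ c h^{−2γ−1}` with `c` depending only on `γ`, `r`, `C_K`. -/
theorem statement11 (γ C_K : ℝ) (r : ℕ) (hγ : 0 ≤ γ) (hC_K : 0 < C_K)
    (hr : γ + 1 < r) :
    ∃ c > 0, ∀ K : ℝ → ℝ,
      Function.support K ⊆ Icc 0 1 →
      ContDiff ℝ (r : ℕ∞) K →
      (∀ j ≤ r, ∀ x ∈ Icc (0:ℝ) 1, |iteratedDeriv j K x| ≤ C_K) →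
      ∀ h : ℝ, 0 < h → h < 1 →
        ∫ ω : ℝ, ‖∫ t in Icc (0:ℝ) 1,
              Complex.exp (-(Complex.I * (ω:ℂ) * (h:ℂ) * (t:ℂ))) * (K t : ℂ)‖ ^ 2 *
            |ω| ^ (2 * γ)
          ≤ c * h ^ (-2 * γ - 1) := by
  set J : ℝ → ℝ := fun η => (1 + |η|) ^ (-(2 * (r : ℝ) - 2 * γ)) with hJ
  have hJint : Integrable J := by
    refine integrable_one_add_norm (E := ℝ) ?_
    rw [Module.finrank_self, Nat.cast_one]
    linarith
  have hJ0 : 0 ≤ ∫ η, J η := integral_nonneg fun η => by positivity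
  refine ⟨(2 ^ r * C_K) ^ 2 * ((∫ η, J η) + 1), by positivity, ?_⟩
  intro K hsupp hK hbound h hh _
  set f : ℝ → ℂ := fun t => (K t : ℂ) with hf
  have hfsupp : Function.support f ⊆ Icc 0 1 := fun t ht => hsupp fun h0 => ht (by simp [hf, h0])
  have hfr : ContDiff ℝ (r : ℕ∞) f := Complex.ofRealCLM.contDiff.comp hK
  have hfC : ∀ j ≤ r, ∀ x ∈ Icc (0 : ℝ) 1, ‖iteratedDeriv j f x‖ ≤ C_K := by
    intro j hj x hx
    have hnorm := Complex.ofRealLI.norm_iteratedFDeriv_comp_left (x := x) hK.contDiffAt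
      (i := j) (by exact_mod_cast hj)
    rw [norm_iteratedFDeriv_eq_norm_iteratedDeriv, norm_iteratedFDeriv_eq_norm_iteratedDeriv]
      at hnorm
    exact hnorm.trans_le (hbound j hj x hx)
  have hpt (ω : ℝ) : ‖∫ t in Icc (0:ℝ) 1,
        Complex.exp (-(Complex.I * (ω:ℂ) * (h:ℂ) * (t:ℂ))) * (K t : ℂ)‖ ^ 2 * |ω| ^ (2 * γ) ≤
      h ^ (-2 * γ) * (2 ^ r * C_K) ^ 2 * J (ω * h) := by
    have hdecay := sq_mul_rpow_le_of_one_add_pow_mul_le hγ (abs_nonneg (ω * h)) (norm_nonneg _)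
      (one_add_abs_pow_mul_norm_setIntegral_le hfsupp hfr hfC (ω * h))
    have hω : |ω| ^ (2 * γ) = h ^ (-2 * γ) * |ω * h| ^ (2 * γ) := by
      rw [abs_mul, abs_of_pos hh, Real.mul_rpow (abs_nonneg ω) hh.le, mul_left_comm,
        ← Real.rpow_add hh]
      simp
    rw [hω, mul_left_comm, mul_assoc]
    simp only [Complex.ofReal_mul, mul_assoc] at hdecay ⊢
    gcongr
  calc _ ≤ ∫ ω, h ^ (-2 * γ) * (2 ^ r * C_K) ^ 2 * J (ω * h) :=
        integral_mono_of_nonneg (Filter.Eventually.of_forall fun ω => by positivity)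
          ((hJint.comp_mul_right' hh.ne').const_mul _) (Filter.Eventually.of_forall hpt)
    _ = (2 ^ r * C_K) ^ 2 * (∫ η, J η) * h ^ (-2 * γ - 1) := by
        rw [integral_const_mul, Measure.integral_comp_mul_right, abs_of_pos (inv_pos.2 hh),
          Real.rpow_sub_one hh.ne', smul_eq_mul]
        ring
    _ ≤ (2 ^ r * C_K) ^ 2 * ((∫ η, J η) + 1) * h ^ (-2 * γ - 1) := by
        gcongr
        linarith
end

section
/- Let g : ℝ → ℂ be integrable and square-integrable, let δ > 0, p > 0 and x₀ ≥ 0, and define F(t) := (1/(2π)) ∫_{−∞}^{∞} g(ω) e^{(−δ+iω)(t−x₀)} dω for t ∈ ℝ. Then there exists a constant C > 0 depending only on p such that ∫₀^∞ |F(t)|² t^p dt ≤ C δ^{−p} e^{2δx₀} ∫_{−∞}^{∞} |g(ω)|² dω. -/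
open MeasureTheory Set FourierTransform
open scoped SchwartzMap

/-- On `L¹ ∩ L²`, the `L²` Fourier transform agrees a.e. with the Fourier integral. -/
theorem fourier_toLp_ae_eq {g : ℝ → ℂ} (hg : Integrable g) (hg2 : MemLp g 2) :
    (𝓕 (hg2.toLp g) : Lp ℂ 2 (volume : Measure ℝ)) =ᵐ[volume] 𝓕 g := by
  have hcont : Continuous (𝓕 g) :=
    VectorFourier.fourierIntegral_continuous Real.continuous_fourierChar
      (by exact continuous_inner) hg
  refine ae_eq_of_integral_contDiff_smul_eq
    ((Lp.memLp _).locallyIntegrable one_le_two) hcont.locallyIntegrable ?_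
  intro φ hφ hφc
  have hφs : HasCompactSupport (fun x => (φ x : ℂ)) := hφc.comp_left Complex.ofReal_zero
  let Φ : 𝓢(ℝ, ℂ) := hφs.toSchwartzMap (Complex.ofRealCLM.contDiff.comp hφ)
  have hΦ : ∀ x, Φ x = φ x := fun x => rfl
  have h1 := DFunLike.congr_fun (Lp.fourier_toTemperedDistribution_eq (hg2.toLp g)) Φ
  rw [TemperedDistribution.fourier_apply, Lp.toTemperedDistribution_apply,
    Lp.toTemperedDistribution_apply] at h1
  have h2 : ∫ x, (𝓕 (Φ : ℝ → ℂ)) x • g x = ∫ x, Φ x • (𝓕 g) x := by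
    have := VectorFourier.integral_fourierIntegral_smul_eq_flip (μ := volume) (ν := volume)
      (L := innerₗ ℝ) (f := Φ) (g := g) Real.continuous_fourierChar
      (by exact continuous_inner) Φ.integrable hg
    rwa [flip_innerₗ] at this
  have h3 : ∫ x, (𝓕 Φ) x • (hg2.toLp g) x = ∫ x, (𝓕 (Φ : ℝ → ℂ)) x • g x := by
    refine integral_congr_ae ?_
    filter_upwards [hg2.coeFn_toLp] with x hx
    rw [hx, SchwartzMap.fourier_coe]
  have h4 := h1.symm.trans (h3.trans h2)
  simp only [hΦ, smul_eq_mul] at h4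
  simpa only [Complex.real_smul] using h4

theorem memLp_two_fourier {g : ℝ → ℂ} (hg : Integrable g) (hg2 : MemLp g 2) :
    MemLp (𝓕 g) 2 :=
  (Lp.memLp _).ae_eq (fourier_toLp_ae_eq hg hg2)

theorem eLpNorm_two_fourier {g : ℝ → ℂ} (hg : Integrable g) (hg2 : MemLp g 2) :
    eLpNorm (𝓕 g) 2 = eLpNorm g 2 := by
  have h := Lp.norm_fourier_eq (hg2.toLp g)
  rw [Lp.norm_def, Lp.norm_def, eLpNorm_congr_ae (fourier_toLp_ae_eq hg hg2),
    eLpNorm_congr_ae hg2.coeFn_toLp] at h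
  exact (ENNReal.toReal_eq_toReal_iff' (memLp_two_fourier hg hg2).eLpNorm_ne_top
    hg2.eLpNorm_ne_top).mp h

/-- Plancherel's theorem for the Fourier integral on `L¹ ∩ L²`. -/
theorem integral_norm_sq_fourier {g : ℝ → ℂ} (hg : Integrable g) (hg2 : MemLp g 2) :
    ∫ ξ, ‖𝓕 g ξ‖ ^ 2 = ∫ x, ‖g x‖ ^ 2 := by
  have h := eLpNorm_two_fourier hg hg2
  rw [(memLp_two_fourier hg hg2).eLpNorm_eq_integral_rpow_norm two_ne_zero ENNReal.ofNat_ne_top,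
    hg2.eLpNorm_eq_integral_rpow_norm two_ne_zero ENNReal.ofNat_ne_top] at h
  simp only [ENNReal.toReal_ofNat, Real.rpow_two] at h
  have h0 : ∀ f : ℝ → ℂ, 0 ≤ ∫ x, ‖f x‖ ^ 2 := fun f => integral_nonneg fun x => by positivity
  rw [ENNReal.ofReal_eq_ofReal_iff (Real.rpow_nonneg (h0 _) _) (Real.rpow_nonneg (h0 _) _),
    Real.rpow_left_inj (h0 _) (h0 _) (by norm_num)] at h
  exact h

theorem rpow_mul_exp_neg_le {p δ t : ℝ} (hp : 0 < p) (hδ : 0 < δ) (ht : 0 < t) :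
    t ^ p * Real.exp (-(2 * δ * t)) ≤ p ^ p * δ ^ (-p) := by
  have h1 : (δ * t / p) ^ p ≤ Real.exp (δ * t) := by
    calc (δ * t / p) ^ p ≤ Real.exp (δ * t / p) ^ p := by
          gcongr
          linarith [Real.add_one_le_exp (δ * t / p)]
      _ = Real.exp (δ * t) := by rw [← Real.exp_mul]; field_simp
  have h2 : t ^ p = p ^ p * δ ^ (-p) * (δ * t / p) ^ p := by
    rw [Real.div_rpow (by positivity) hp.le, Real.mul_rpow hδ.le ht.le, Real.rpow_neg hδ.le]
    field_simp
  calc t ^ p * Real.exp (-(2 * δ * t))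
      ≤ p ^ p * δ ^ (-p) * Real.exp (δ * t) * Real.exp (-(2 * δ * t)) := by rw [h2]; gcongr
    _ = p ^ p * δ ^ (-p) * Real.exp (-(δ * t)) := by
        rw [mul_assoc, ← Real.exp_add]; ring_nf
    _ ≤ p ^ p * δ ^ (-p) * 1 := by
        gcongr
        exact Real.exp_le_one_iff.mpr (by nlinarith [mul_pos hδ ht])
    _ = _ := mul_one _

theorem norm_integral_mul_exp_eq (g : ℝ → ℂ) (δ s : ℝ) :
    ‖∫ ω : ℝ, g ω * Complex.exp ((-(δ : ℂ) + Complex.I * (ω : ℂ)) * (s : ℂ))‖ =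
      Real.exp (-(δ * s)) * ‖𝓕 g (-s / (2 * Real.pi))‖ := by
  have h : ∫ ω : ℝ, g ω * Complex.exp ((-(δ : ℂ) + Complex.I * (ω : ℂ)) * (s : ℂ)) =
      (Real.exp (-(δ * s)) : ℂ) * 𝓕 g (-s / (2 * Real.pi)) := by
    rw [Real.fourier_real_eq_integral_exp_smul, ← integral_const_mul]
    congr 1 with ω
    have hpi : (Real.pi : ℂ) ≠ 0 := Complex.ofReal_ne_zero.mpr Real.pi_ne_zero
    rw [smul_eq_mul, Complex.ofReal_exp, ← mul_assoc, ← Complex.exp_add, mul_comm (g ω)]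
    congr 2
    push_cast
    field_simp
  rw [h, norm_mul, Complex.norm_real, Real.norm_of_nonneg (Real.exp_pos _).le]

/-- Weighted L² variance bound: for `F(t) = (1/2π) ∫ g(ω) e^{(−δ+iω)(t−x₀)} dω`,
`∫₀^∞ |F(t)|² t^p dt ≤ C δ^{−p} e^{2δx₀} ∫ |g(ω)|² dω` with `C = C(p)`. -/
theorem statement12 (p : ℝ) (hp : 0 < p) :
    ∃ C > 0, ∀ (g : ℝ → ℂ) (δ x₀ : ℝ) (F : ℝ → ℂ),
      Integrable g → Integrable (fun ω : ℝ => ‖g ω‖ ^ 2) →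
      0 < δ → 0 ≤ x₀ →
      (∀ t : ℝ, F t = (1 / (2 * (Real.pi : ℂ))) *
        ∫ ω : ℝ, g ω * Complex.exp ((-(δ:ℂ) + Complex.I * (ω:ℂ)) * ((t:ℂ) - (x₀:ℂ)))) →
      ∫ t in Ioi (0:ℝ), ‖F t‖ ^ 2 * t ^ p
        ≤ C * δ ^ (-p) * Real.exp (2 * δ * x₀) * ∫ ω : ℝ, ‖g ω‖ ^ 2 := by
  have hpi := Real.pi_pos
  refine ⟨p ^ p / (2 * Real.pi), by positivity, fun g δ x₀ F hg hgsq hδ _ hF => ?_⟩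
  have hg2 : MemLp g 2 := (memLp_two_iff_integrable_sq_norm hg.1).mpr hgsq
  have hFg : Integrable fun ξ => ‖𝓕 g ξ‖ ^ 2 :=
    (memLp_two_iff_integrable_sq_norm (memLp_two_fourier hg hg2).1).mp (memLp_two_fourier hg hg2)
  set A : ℝ := (1 / (2 * Real.pi)) ^ 2 * (p ^ p * δ ^ (-p)) * Real.exp (2 * δ * x₀) with hA
  have hbound : ∀ t ∈ Ioi (0 : ℝ),
      ‖F t‖ ^ 2 * t ^ p ≤ A * ‖𝓕 g ((x₀ - t) / (2 * Real.pi))‖ ^ 2 := by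
    intro t (ht : 0 < t)
    have hn : ‖F t‖ = 1 / (2 * Real.pi) *
        (Real.exp (-(δ * (t - x₀))) * ‖𝓕 g ((x₀ - t) / (2 * Real.pi))‖) := by
      rw [hF t, ← Complex.ofReal_sub, norm_mul, norm_integral_mul_exp_eq, neg_sub]
      simp [abs_of_pos hpi]
    have he : Real.exp (-(δ * (t - x₀))) ^ 2 =
        Real.exp (-(2 * δ * t)) * Real.exp (2 * δ * x₀) := by
      rw [← Real.exp_nat_mul, ← Real.exp_add]
      push_cast
      ring_nf
    calc ‖F t‖ ^ 2 * t ^ p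
        = (1 / (2 * Real.pi)) ^ 2 * (t ^ p * Real.exp (-(2 * δ * t))) * Real.exp (2 * δ * x₀) *
            ‖𝓕 g ((x₀ - t) / (2 * Real.pi))‖ ^ 2 := by
          rw [hn, mul_pow, mul_pow, he]; ring
      _ ≤ _ := by
          rw [hA]
          gcongr (1 / (2 * Real.pi)) ^ 2 * ?_ * _ * _
          exact rpow_mul_exp_neg_le hp hδ ht
  have hint : Integrable fun t => A * ‖𝓕 g ((x₀ - t) / (2 * Real.pi))‖ ^ 2 :=
    (((hFg.comp_div (by positivity : 2 * Real.pi ≠ 0)).comp_sub_left x₀)).const_mul A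
  calc ∫ t in Ioi (0:ℝ), ‖F t‖ ^ 2 * t ^ p
      ≤ ∫ t in Ioi (0:ℝ), A * ‖𝓕 g ((x₀ - t) / (2 * Real.pi))‖ ^ 2 := by
        refine integral_mono_of_nonneg ?_ hint.integrableOn ?_
        · filter_upwards [ae_restrict_mem measurableSet_Ioi] with t ht
          have : 0 < t := ht
          simp only [Pi.zero_apply]
          positivity
        · filter_upwards [ae_restrict_mem measurableSet_Ioi] with t ht using hbound t ht
    _ ≤ ∫ t, A * ‖𝓕 g ((x₀ - t) / (2 * Real.pi))‖ ^ 2 :=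
        setIntegral_le_integral hint (ae_of_all _ fun t => by simp only [Pi.zero_apply]; positivity)
    _ = A * (2 * Real.pi * ∫ ω, ‖g ω‖ ^ 2) := by
        rw [integral_const_mul,
          integral_sub_left_eq_self (fun s => ‖𝓕 g (s / (2 * Real.pi))‖ ^ 2) volume x₀,
          Measure.integral_comp_div (fun s => ‖𝓕 g s‖ ^ 2), integral_norm_sq_fourier hg hg2,
          abs_of_pos (by positivity), smul_eq_mul]
    _ = p ^ p / (2 * Real.pi) * δ ^ (-p) * Real.exp (2 * δ * x₀) * ∫ ω, ‖g ω‖ ^ 2 := by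
        rw [hA]
        field_simp
end

section
/- Let b > 1/4, let r be a positive integer, and let ψ : ℝ → [0,1] be r times continuously differentiable, equal to 0 outside [−1/4, b+1/4], with its r-th derivative vanishing on (0,b) and satisfying |ψ^{(r)}(t)| ≤ D for all t ∈ ℝ. Then for all σ > 0 and ω ∈ ℝ: |∫_{−∞}^{∞} ψ(t) e^{(σ−iω)t} dt| ≤ (D/2) e^{σ(b+1/4)} (σ² + ω²)^{−r/2}. -/
open MeasureTheory Set

/-- Integration by parts for the bilateral Laplace transform of a compactly supported function. -/
theorem integral_deriv_mul_cexp {f : ℝ → ℝ} (hf : ContDiff ℝ 1 f) (hc : HasCompactSupport f)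
    (z : ℂ) :
    ∫ t : ℝ, ((deriv f t : ℝ) : ℂ) * Complex.exp (z * t) =
      -z * ∫ t : ℝ, (f t : ℂ) * Complex.exp (z * t) := by
  have hf' : Continuous (deriv f) := hf.continuous_deriv le_rfl
  have hf0 : Continuous f := hf.continuous
  have hcc : HasCompactSupport fun t : ℝ => (f t : ℂ) := hc.comp_left Complex.ofReal_zero
  have hcc' : HasCompactSupport fun t : ℝ => ((deriv f t : ℝ) : ℂ) :=
    hc.deriv.comp_left Complex.ofReal_zero
  have hexp (t : ℝ) : HasDerivAt (fun t : ℝ => Complex.exp (z * t)) (Complex.exp (z * t) * z) t :=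
    (((hasDerivAt_id (t : ℂ)).const_mul z).cexp.comp_ofReal).congr_deriv (by simp)
  have hparts := integral_mul_deriv_eq_deriv_mul_of_integrable
    (fun t _ => ((hf.differentiable one_ne_zero) t).hasDerivAt.ofReal_comp) (fun t _ => hexp t)
    ((by fun_prop : Continuous fun t : ℝ => (f t : ℂ) * (Complex.exp (z * t) * z))
      |>.integrable_of_hasCompactSupport hcc.mul_right)
    ((by fun_prop : Continuous fun t : ℝ => ((deriv f t : ℝ) : ℂ) * Complex.exp (z * t))
      |>.integrable_of_hasCompactSupport hcc'.mul_right)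
    ((by fun_prop : Continuous fun t : ℝ => (f t : ℂ) * Complex.exp (z * t))
      |>.integrable_of_hasCompactSupport hcc.mul_right)
  rw [← integral_const_mul, ← neg_eq_iff_eq_neg.mpr hparts, ← integral_neg]
  exact integral_congr_ae (.of_forall fun t => by ring)

theorem integral_iteratedDeriv_mul_cexp (n : ℕ) {f : ℝ → ℝ} (hf : ContDiff ℝ n f)
    (hc : HasCompactSupport f) (z : ℂ) :
    ∫ t : ℝ, ((iteratedDeriv n f t : ℝ) : ℂ) * Complex.exp (z * t) =
      (-z) ^ n * ∫ t : ℝ, (f t : ℂ) * Complex.exp (z * t) := by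
  induction n generalizing f with
  | zero => simp
  | succ n ih =>
    have hd : ContDiff ℝ n (deriv f) := by
      have := (contDiff_succ_iff_deriv (n := n)).1 (by exact_mod_cast hf)
      exact this.2.2
    rw [iteratedDeriv_succ', ih hd hc.deriv,
      integral_deriv_mul_cexp (hf.of_le (by norm_cast; omega)) hc, pow_succ, mul_assoc]

theorem iteratedDeriv_eq_zero_of_notMem {f : ℝ → ℝ} {s : Set ℝ} (hs : IsClosed s)
    (hf : ∀ t ∉ s, f t = 0) (n : ℕ) {t : ℝ} (ht : t ∉ s) : iteratedDeriv n f t = 0 := by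
  have h : f =ᶠ[nhds t] fun _ => (0 : ℝ) := by
    filter_upwards [hs.isOpen_compl.mem_nhds ht] with x hx using hf x hx
  rw [h.iteratedDeriv_eq n]
  simp

/-- Decay of the bilateral Laplace transform of the smooth cutoff `ψ`:
`|ψ̂(−σ+iω)| ≤ (D/2) e^{σ(b+1/4)} (σ²+ω²)^{−r/2}`. -/
theorem statement13 (b D : ℝ) (r : ℕ) (hb : 1/4 < b) (hr : 0 < r)
    (ψ : ℝ → ℝ)
    (hψ_range : ∀ t, ψ t ∈ Icc (0:ℝ) 1)
    (hψ_smooth : ContDiff ℝ (r : ℕ∞) ψ)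
    (hψ_supp : ∀ t ∉ Icc (-(1/4):ℝ) (b + 1/4), ψ t = 0)
    (hψ_deriv_zero : ∀ t ∈ Ioo (0:ℝ) b, iteratedDeriv r ψ t = 0)
    (hψ_deriv_bdd : ∀ t, |iteratedDeriv r ψ t| ≤ D) :
    ∀ σ ω : ℝ, 0 < σ →
      ‖∫ t : ℝ, (ψ t : ℂ) * Complex.exp (((σ:ℂ) - Complex.I * (ω:ℂ)) * (t:ℂ))‖
        ≤ (D / 2) * Real.exp (σ * (b + 1/4)) * (σ ^ 2 + ω ^ 2) ^ (-(r:ℝ) / 2) := by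
  intro σ ω hσ
  set z : ℂ := (σ : ℂ) - Complex.I * (ω : ℂ) with hz
  have hD : 0 ≤ D := (abs_nonneg _).trans (hψ_deriv_bdd 0)
  have hpos : 0 < σ ^ 2 + ω ^ 2 := by positivity
  have hre : z.re = σ := by simp [hz]
  have hnorm : ‖z‖ ^ r = (σ ^ 2 + ω ^ 2) ^ ((r : ℝ) / 2) := by
    have : ‖z‖ = Real.sqrt (σ ^ 2 + ω ^ 2) := by
      rw [Complex.norm_eq_sqrt_sq_add_sq]
      simp [hz]
    rw [this, Real.sqrt_eq_rpow, ← Real.rpow_natCast, ← Real.rpow_mul hpos.le]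
    ring_nf
  have hparts := integral_iteratedDeriv_mul_cexp r (by exact_mod_cast hψ_smooth)
    (HasCompactSupport.intro isCompact_Icc hψ_supp) z
  set S : Set ℝ := Icc (-(1/4)) 0 ∪ Icc b (b + 1/4) with hS
  have hvol : volume.real S ≤ 1 / 2 := by
    refine (measureReal_union_le _ _).trans ?_
    rw [Real.volume_real_Icc_of_le (by norm_num), Real.volume_real_Icc_of_le (by linarith)]
    linarith
  have hzero (t : ℝ) (ht : t ∉ S) :
      ((iteratedDeriv r ψ t : ℝ) : ℂ) * Complex.exp (z * t) = 0 := by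
    suffices iteratedDeriv r ψ t = 0 by simp [this]
    by_cases htI : t ∈ Icc (-(1/4) : ℝ) (b + 1/4)
    · apply hψ_deriv_zero
      simp only [hS, mem_union, mem_Icc, not_or, not_and, not_le] at ht htI
      exact ⟨ht.1 htI.1, by by_contra! h; linarith [ht.2 h]⟩
    · exact iteratedDeriv_eq_zero_of_notMem isClosed_Icc hψ_supp r htI
  have hbound : ‖∫ t : ℝ, ((iteratedDeriv r ψ t : ℝ) : ℂ) * Complex.exp (z * t)‖ ≤
      D / 2 * Real.exp (σ * (b + 1/4)) := by
    rw [← setIntegral_eq_integral_of_forall_compl_eq_zero hzero]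
    have hSfin : volume S < ⊤ := (isCompact_Icc.union isCompact_Icc).measure_lt_top
    refine (norm_setIntegral_le_of_norm_le_const (C := D * Real.exp (σ * (b + 1/4))) hSfin
      fun t ht => ?_).trans ?_
    · have ht' : t ≤ b + 1/4 := by
        rcases ht with ht | ht
        · linarith [ht.2]
        · exact ht.2
      rw [norm_mul, Complex.norm_real, Real.norm_eq_abs, Complex.norm_exp, Complex.re_mul_ofReal,
        hre]
      gcongr
      exact hψ_deriv_bdd t
    · calc D * Real.exp (σ * (b + 1/4)) * volume.real S
          ≤ D * Real.exp (σ * (b + 1/4)) * (1 / 2) := by gcongr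
        _ = D / 2 * Real.exp (σ * (b + 1/4)) := by ring
  rw [hparts, norm_mul, norm_pow, norm_neg, hnorm] at hbound
  rw [neg_div, Real.rpow_neg hpos.le, ← div_eq_mul_inv, le_div_iff₀ (by positivity), mul_comm]
  exact hbound
end

section
/- For every h > 0, every c < 0 and every t ∈ ℝ: −(1/(2π)) ∫_{−∞}^{∞} (c+iω) e^{(c+iω)t + h²(c+iω)²/2} dω = t e^{−t²/(2h²)} / (√(2π) h³). -/
open MeasureTheory Set

/-- The first moment of a complex Gaussian exponential is absolutely convergent. -/
lemma integrable_mul_cexp_quadratic {b : ℂ} (hb : b.re < 0) (c d : ℂ) :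
    Integrable (fun x : ℝ ↦ (x : ℂ) * Complex.exp (b * x ^ 2 + c * x + d)) := by
  have hp := (integrable_cexp_quadratic' hb (c + 1) d).norm
  have hm := (integrable_cexp_quadratic' hb (c - 1) d).norm
  refine (hp.add hm).mono' (by fun_prop) (Filter.Eventually.of_forall fun x ↦ ?_)
  have ep : b * x ^ 2 + (c + 1) * x + d = (x : ℂ) + (b * x ^ 2 + c * x + d) := by ring
  have em : b * x ^ 2 + (c - 1) * x + d = ((-x : ℝ) : ℂ) + (b * x ^ 2 + c * x + d) := by
    push_cast; ring
  simp only [Pi.add_apply, ep, em, Complex.exp_add _ (b * (x : ℂ) ^ 2 + c * x + d), norm_mul,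
    Complex.norm_exp_ofReal, Complex.norm_real, Real.norm_eq_abs, ← add_mul]
  gcongr
  rcases abs_cases x with ⟨h, -⟩ | ⟨h, -⟩ <;> rw [h] <;>
    linarith [Real.add_one_le_exp x, Real.add_one_le_exp (-x), Real.exp_pos x,
      Real.exp_pos (-x)]

/-- The derivative of a complex Gaussian exponential is integrable. -/
lemma integrable_linear_mul_cexp_quadratic {b : ℂ} (hb : b.re < 0) (c d : ℂ) :
    Integrable (fun x : ℝ ↦ (2 * b * x + c) * Complex.exp (b * x ^ 2 + c * x + d)) := by
  refine (((integrable_mul_cexp_quadratic hb c d).const_mul (2 * b)).add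
    ((integrable_cexp_quadratic' hb c d).const_mul c)).congr
      (Filter.Eventually.of_forall fun x ↦ ?_)
  simp only [Pi.add_apply]
  ring

/-- The derivative of a complex Gaussian exponential has integral zero. -/
lemma integral_linear_mul_cexp_quadratic {b : ℂ} (hb : b.re < 0) (c d : ℂ) :
    ∫ x : ℝ, (2 * b * x + c) * Complex.exp (b * x ^ 2 + c * x + d) = 0 := by
  refine integral_eq_zero_of_hasDerivAt_of_integrable
    (f := fun x : ℝ ↦ Complex.exp (b * x ^ 2 + c * x + d)) (fun x ↦ ?_)
    (integrable_linear_mul_cexp_quadratic hb c d) (integrable_cexp_quadratic' hb c d)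
  have hx : HasDerivAt (fun y : ℝ ↦ (y : ℂ)) 1 x := Complex.ofRealCLM.hasDerivAt
  refine ((((hx.pow 2).const_mul b).add (hx.const_mul c)).add_const d).cexp.congr_deriv ?_
  simp only [Pi.add_apply, Pi.pow_apply]
  push_cast
  ring

/-- Explicit deconvolution kernel for constant arrival rate and Gaussian kernel:
`−(1/2π) ∫ (c+iω) e^{(c+iω)t + h²(c+iω)²/2} dω = t e^{−t²/(2h²)} / (√(2π) h³)`. -/
theorem statement15 (h c t : ℝ) (hh : 0 < h) (hc : c < 0) :
    -(1 / (2 * (Real.pi : ℂ))) *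
        ∫ ω : ℝ, ((c:ℂ) + Complex.I * (ω:ℂ)) *
          Complex.exp (((c:ℂ) + Complex.I * (ω:ℂ)) * (t:ℂ)
            + (h:ℂ) ^ 2 * ((c:ℂ) + Complex.I * (ω:ℂ)) ^ 2 / 2)
      = ((t * Real.exp (-t ^ 2 / (2 * h ^ 2)) / (Real.sqrt (2 * Real.pi) * h ^ 3) : ℝ) : ℂ) := by
  have hb : (-(h : ℂ) ^ 2 / 2).re < 0 := by
    rw [show -(h : ℂ) ^ 2 / 2 = ((-h ^ 2 / 2 : ℝ) : ℂ) by push_cast; ring, Complex.ofReal_re]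
    have := pow_pos hh 2
    linarith
  have hh' : (h : ℂ) ≠ 0 := Complex.ofReal_ne_zero.mpr hh.ne'
  set b : ℂ := -(h : ℂ) ^ 2 / 2 with hbdef
  set k : ℂ := Complex.I * (t + h ^ 2 * c) with hk
  set d : ℂ := c * t + h ^ 2 * c ^ 2 / 2 with hd
  have hint (ω : ℝ) : ((c : ℂ) + Complex.I * ω) *
      Complex.exp ((c + Complex.I * ω) * t + (h : ℂ) ^ 2 * (c + Complex.I * ω) ^ 2 / 2) =
      (-Complex.I / h ^ 2) * ((2 * b * ω + k) * Complex.exp (b * ω ^ 2 + k * ω + d)) -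
      (t / h ^ 2) * Complex.exp (b * ω ^ 2 + k * ω + d) := by
    rw [show ((c : ℂ) + Complex.I * ω) * t + (h : ℂ) ^ 2 * (c + Complex.I * ω) ^ 2 / 2 =
      b * ω ^ 2 + k * ω + d by
        rw [hbdef, hk, hd]; linear_combination (h : ℂ) ^ 2 * ω ^ 2 / 2 * Complex.I_sq]
    rw [← mul_assoc, ← sub_mul]
    congr 1
    rw [hbdef, hk]
    field_simp
    linear_combination (t + (h : ℂ) ^ 2 * c) * Complex.I_sq
  have hE := integrable_cexp_quadratic' hb k d
  have hD := integrable_linear_mul_cexp_quadratic hb k d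
  have hexp : d - k ^ 2 / (4 * b) = ((-t ^ 2 / (2 * h ^ 2) : ℝ) : ℂ) := by
    rw [hbdef, hk, hd]
    push_cast
    field_simp
    linear_combination 4 * (t + (h : ℂ) ^ 2 * c) ^ 2 * Complex.I_sq
  have hsqrt : ((Real.pi : ℂ) / -b) ^ (1 / 2 : ℂ) = ((Real.sqrt (2 * Real.pi) / h : ℝ) : ℂ) := by
    rw [show (Real.pi : ℂ) / -b = ((2 * Real.pi / h ^ 2 : ℝ) : ℂ) by
        rw [hbdef]; push_cast; field_simp,
      show (1 / 2 : ℂ) = ((1 / 2 : ℝ) : ℂ) by push_cast; ring,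
      ← Complex.ofReal_cpow (by positivity), ← Real.sqrt_eq_rpow,
      Real.sqrt_div (by positivity), Real.sqrt_sq hh.le]
  simp_rw [hint]
  rw [integral_sub (hD.const_mul _) (hE.const_mul _), integral_const_mul, integral_const_mul,
    integral_linear_mul_cexp_quadratic hb, integral_cexp_quadratic hb, hsqrt, hexp,
    ← Complex.ofReal_exp]
  have hs : (Real.sqrt (2 * Real.pi) : ℂ) ^ 2 = 2 * Real.pi := by
    exact_mod_cast Real.sq_sqrt (by positivity : 0 ≤ 2 * Real.pi)
  have hs0 : (Real.sqrt (2 * Real.pi) : ℂ) ≠ 0 :=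
    Complex.ofReal_ne_zero.mpr (by positivity)
  rw [← hs]
  simp only [Complex.ofReal_div, Complex.ofReal_mul, Complex.ofReal_pow]
  field_simp
  ring
end

section
/- For every h > 0, every b > 0, every c < 0 and every t ∈ ℝ: −(1/(2π)) ∫_{−∞}^{∞} (1 − e^{−(c+iω)b}) e^{(c+iω)t + h²(c+iω)²/2} dω = (1/(√(2π) h)) (e^{−(b−t)²/(2h²)} − e^{−t²/(2h²)}). -/
open MeasureTheory Set

/-- On a vertical line, the Gaussian Laplace integrand is the exponential of a quadratic. -/
theorem verticalGaussian_exponent (h c s ω : ℝ) :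
    ((c : ℂ) + Complex.I * (ω : ℂ)) * (s : ℂ)
        + (h : ℂ) ^ 2 * ((c : ℂ) + Complex.I * (ω : ℂ)) ^ 2 / 2
      = -((h : ℂ) ^ 2 / 2) * (ω : ℂ) ^ 2 + Complex.I * (s + h ^ 2 * c) * (ω : ℂ)
        + (c * s + h ^ 2 * c ^ 2 / 2) := by
  linear_combination ((h : ℂ) ^ 2 * (ω : ℂ) ^ 2 / 2) * Complex.I_sq

theorem neg_sq_div_two_re_neg {h : ℝ} (hh : 0 < h) : (-((h : ℂ) ^ 2 / 2)).re < 0 := by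
  have : (-((h : ℂ) ^ 2 / 2)) = ((-(h ^ 2 / 2) : ℝ) : ℂ) := by push_cast; ring
  rw [this, Complex.ofReal_re]
  have : 0 < h ^ 2 := by positivity
  linarith

theorem integrable_verticalGaussian {h : ℝ} (hh : 0 < h) (c s : ℝ) :
    Integrable fun ω : ℝ => Complex.exp (((c : ℂ) + Complex.I * (ω : ℂ)) * (s : ℂ)
      + (h : ℂ) ^ 2 * ((c : ℂ) + Complex.I * (ω : ℂ)) ^ 2 / 2) := by
  simp_rw [verticalGaussian_exponent]
  exact integrable_cexp_quadratic' (neg_sq_div_two_re_neg hh) _ _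

theorem integral_verticalGaussian {h : ℝ} (hh : 0 < h) (c s : ℝ) :
    ∫ ω : ℝ, Complex.exp (((c : ℂ) + Complex.I * (ω : ℂ)) * (s : ℂ)
      + (h : ℂ) ^ 2 * ((c : ℂ) + Complex.I * (ω : ℂ)) ^ 2 / 2)
      = ((Real.sqrt (2 * Real.pi) / h * Real.exp (-s ^ 2 / (2 * h ^ 2)) : ℝ) : ℂ) := by
  simp_rw [verticalGaussian_exponent]
  rw [integral_cexp_quadratic (neg_sq_div_two_re_neg hh)]
  have hne : (h : ℂ) ≠ 0 := by exact_mod_cast hh.ne'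
  have hroot : ((Real.pi : ℂ) / -(-((h : ℂ) ^ 2 / 2))) ^ (1 / 2 : ℂ)
      = ((Real.sqrt (2 * Real.pi) / h : ℝ) : ℂ) := by
    have hbase : (Real.pi : ℂ) / -(-((h : ℂ) ^ 2 / 2)) = ((2 * Real.pi / h ^ 2 : ℝ) : ℂ) := by
      push_cast
      field_simp
    have hhalf : (1 / 2 : ℂ) = ((1 / 2 : ℝ) : ℂ) := by norm_num
    rw [hbase, hhalf, ← Complex.ofReal_cpow (by positivity), ← Real.sqrt_eq_rpow,
      Real.sqrt_div (by positivity), Real.sqrt_sq hh.le]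
  have hexp : ((c : ℂ) * s + h ^ 2 * c ^ 2 / 2)
      - (Complex.I * (s + h ^ 2 * c)) ^ 2 / (4 * -((h : ℂ) ^ 2 / 2))
      = ((-s ^ 2 / (2 * h ^ 2) : ℝ) : ℂ) := by
    rw [mul_pow, Complex.I_sq]
    push_cast
    field_simp
    ring
  rw [hroot, hexp, ← Complex.ofReal_exp, ← Complex.ofReal_mul]

/-- Explicit kernel `J_b` for constant arrival rate and Gaussian kernel:
`−(1/2π) ∫ (1−e^{−(c+iω)b}) e^{(c+iω)t + h²(c+iω)²/2} dω
  = (1/(√(2π)h)) (e^{−(b−t)²/(2h²)} − e^{−t²/(2h²)})`. -/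
theorem statement16 (h b c t : ℝ) (hh : 0 < h) (hb : 0 < b) (hc : c < 0) :
    -(1 / (2 * (Real.pi : ℂ))) *
        ∫ ω : ℝ, (1 - Complex.exp (-(((c:ℂ) + Complex.I * (ω:ℂ)) * (b:ℂ)))) *
          Complex.exp (((c:ℂ) + Complex.I * (ω:ℂ)) * (t:ℂ)
            + (h:ℂ) ^ 2 * ((c:ℂ) + Complex.I * (ω:ℂ)) ^ 2 / 2)
      = (((1 / (Real.sqrt (2 * Real.pi) * h)) *
          (Real.exp (-(b - t) ^ 2 / (2 * h ^ 2)) - Real.exp (-t ^ 2 / (2 * h ^ 2))) : ℝ) : ℂ) := by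
  have hsplit (ω : ℝ) : (1 - Complex.exp (-(((c:ℂ) + Complex.I * (ω:ℂ)) * (b:ℂ)))) *
      Complex.exp (((c:ℂ) + Complex.I * (ω:ℂ)) * (t:ℂ)
        + (h:ℂ) ^ 2 * ((c:ℂ) + Complex.I * (ω:ℂ)) ^ 2 / 2)
      = Complex.exp (((c:ℂ) + Complex.I * (ω:ℂ)) * (t:ℂ)
        + (h:ℂ) ^ 2 * ((c:ℂ) + Complex.I * (ω:ℂ)) ^ 2 / 2)
      - Complex.exp (((c:ℂ) + Complex.I * (ω:ℂ)) * ((t - b : ℝ):ℂ)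
        + (h:ℂ) ^ 2 * ((c:ℂ) + Complex.I * (ω:ℂ)) ^ 2 / 2) := by
    rw [sub_mul, one_mul, ← Complex.exp_add]
    congr 2
    push_cast
    ring
  simp_rw [hsplit]
  rw [integral_sub (integrable_verticalGaussian hh c t) (integrable_verticalGaussian hh c (t - b)),
    integral_verticalGaussian hh, integral_verticalGaussian hh, sub_sq_comm t b]
  have hconst : 1 / (2 * Real.pi) * (Real.sqrt (2 * Real.pi) / h)
      = 1 / (Real.sqrt (2 * Real.pi) * h) := by
    have hpos : 0 < Real.sqrt (2 * Real.pi) := by positivity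
    have hsq : Real.sqrt (2 * Real.pi) ^ 2 = 2 * Real.pi := Real.sq_sqrt (by positivity)
    rw [← hsq, Real.sqrt_sq hpos.le]
    field_simp
  rw [← hconst]
  push_cast
  ring
end

section
/- For every h > 0, every c < 0 and every t ∈ ℝ: (1/(2π)) ∫_{−∞}^{∞} (c+iω)² e^{(c+iω)t + h²(c+iω)²/2} dω = e^{−t²/(2h²)} (t² − h²) / (√(2π) h⁵). -/
open MeasureTheory Set

/-- Polynomially weighted modulated Gaussians are integrable. -/
theorem integrable_pow_mul_cexp_quadratic {b : ℝ} (hb : 0 < b) (d : ℝ) (e : ℂ) (k : ℕ) :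
    Integrable fun x : ℝ ↦ (x : ℂ) ^ k *
      Complex.exp (-(b : ℂ) * (x : ℂ) ^ 2 + (d : ℂ) * Complex.I * (x : ℂ) + e) := by
  have hg : Integrable fun x : ℝ ↦ x ^ k * Real.exp (-b * x ^ 2) := by
    have hk : (-1 : ℝ) < k := by linarith [k.cast_nonneg (α := ℝ)]
    simpa only [Real.rpow_natCast] using integrable_rpow_mul_exp_neg_mul_sq hb hk
  refine (hg.norm.mul_const (Real.exp e.re)).mono' (by fun_prop) (.of_forall fun x ↦ le_of_eq ?_)
  rw [norm_mul, norm_pow, Complex.norm_real, Complex.norm_exp, norm_mul, norm_pow,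
    Real.norm_of_nonneg (Real.exp_pos _).le, mul_assoc (_ ^ k), ← Real.exp_add]
  congr 2
  simp [← Complex.ofReal_pow]

/-- Explicit deconvolution kernel for linearly increasing arrival rate:
`(1/2π) ∫ (c+iω)² e^{(c+iω)t + h²(c+iω)²/2} dω = e^{−t²/(2h²)} (t² − h²) / (√(2π) h⁵)`. -/
theorem statement17 (h c t : ℝ) (hh : 0 < h) (hc : c < 0) :
    (1 / (2 * (Real.pi : ℂ))) *
        ∫ ω : ℝ, ((c:ℂ) + Complex.I * (ω:ℂ)) ^ 2 *
          Complex.exp (((c:ℂ) + Complex.I * (ω:ℂ)) * (t:ℂ)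
            + (h:ℂ) ^ 2 * ((c:ℂ) + Complex.I * (ω:ℂ)) ^ 2 / 2)
      = ((Real.exp (-t ^ 2 / (2 * h ^ 2)) * (t ^ 2 - h ^ 2) /
          (Real.sqrt (2 * Real.pi) * h ^ 5) : ℝ) : ℂ) := by
  have hI : Complex.I ^ 2 = -1 := Complex.I_sq
  have hh0 : (h : ℂ) ≠ 0 := by exact_mod_cast hh.ne'
  set z : ℝ → ℂ := fun ω ↦ (c : ℂ) + Complex.I * (ω : ℂ) with hz
  set E : ℝ → ℂ := fun ω ↦ Complex.exp (z ω * t + (h : ℂ) ^ 2 * z ω ^ 2 / 2) with hE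
  have hE' (ω : ℝ) : E ω = Complex.exp (-((h ^ 2 / 2 : ℝ) : ℂ) * (ω : ℂ) ^ 2
      + ((t + h ^ 2 * c : ℝ) : ℂ) * Complex.I * (ω : ℂ) + (c * t + h ^ 2 * c ^ 2 / 2)) := by
    simp only [hE, hz]
    congr 1
    push_cast
    linear_combination ((h : ℂ) ^ 2 * ω ^ 2 / 2) * hI
  have hpow (k : ℕ) : Integrable fun ω : ℝ ↦ (ω : ℂ) ^ k * E ω := by
    simp only [hE']
    exact integrable_pow_mul_cexp_quadratic (by positivity) _ _ k
  have hE0 : Integrable E := by simpa using hpow 0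
  have hE1 : Integrable fun ω ↦ z ω * E ω := by
    refine ((hE0.const_mul (c : ℂ)).add ((hpow 1).const_mul Complex.I)).congr (.of_forall fun ω ↦ ?_)
    simp only [Pi.add_apply, hz]
    ring
  have hE2 : Integrable fun ω ↦ z ω ^ 2 * E ω := by
    refine ((hE1.const_mul (c : ℂ)).add (((hpow 1).const_mul (c * Complex.I)).add
      ((hpow 2).const_mul (Complex.I ^ 2)))).congr (.of_forall fun ω ↦ ?_)
    simp only [Pi.add_apply, hz]
    ring
  have hzd (ω : ℝ) : HasDerivAt z Complex.I ω := by
    simpa [hz] using ((Complex.ofRealCLM.hasDerivAt (x := ω)).const_mul Complex.I).const_add (c : ℂ)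
  have hEd (ω : ℝ) : HasDerivAt E (Complex.I * (t + h ^ 2 * z ω) * E ω) ω := by
    refine HasDerivAt.congr_deriv (((hzd ω).mul_const (t : ℂ)).add
      ((((hzd ω).pow 2).const_mul ((h : ℂ) ^ 2)).div_const 2)).cexp ?_
    change E ω * _ = _
    push_cast
    ring
  have hFd (ω : ℝ) : HasDerivAt
      (fun ω ↦ -Complex.I / h ^ 2 * (z ω * E ω) + Complex.I * t / h ^ 4 * E ω)
      (z ω ^ 2 * E ω - ((t : ℂ) ^ 2 - h ^ 2) / h ^ 4 * E ω) ω := by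
    refine HasDerivAt.congr_deriv
      ((((hzd ω).mul (hEd ω)).const_mul (-Complex.I / (h : ℂ) ^ 2)).add
      ((hEd ω).const_mul (Complex.I * t / h ^ 4))) ?_
    field_simp
    ring_nf
    rw [hI]
    ring
  have hzero := integral_eq_zero_of_hasDerivAt_of_integrable hFd
    (hE2.sub (hE0.const_mul _)) ((hE1.const_mul _).add (hE0.const_mul _))
  rw [integral_sub hE2 (hE0.const_mul _), integral_const_mul, sub_eq_zero] at hzero
  have hgauss : ∫ ω, E ω =
      ((Real.sqrt (2 * Real.pi) / h * Real.exp (-t ^ 2 / (2 * h ^ 2)) : ℝ) : ℂ) := by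
    simp only [hE']
    rw [integral_cexp_quadratic (by
      rw [← Complex.ofReal_neg, Complex.ofReal_re]; exact neg_lt_zero.mpr (by positivity))]
    have hs : Real.sqrt (2 * Real.pi) / h = (Real.pi / (h ^ 2 / 2)) ^ (1 / 2 : ℝ) := by
      rw [← Real.sqrt_eq_rpow, ← Real.sqrt_sq hh.le, ← Real.sqrt_div (by positivity),
        Real.sqrt_sq hh.le]
      congr 1
      field_simp
    rw [Complex.ofReal_mul, hs, Complex.ofReal_cpow (by positivity), Complex.ofReal_exp]
    congr 2
    · simp
    · simp
    · push_cast
      field_simp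
      ring_nf
      rw [hI]
      ring
  have hπ : Real.sqrt (2 * Real.pi) ^ 2 = 2 * Real.pi := Real.sq_sqrt (by positivity)
  have hs0 : Real.sqrt (2 * Real.pi) ≠ 0 := by positivity
  change 1 / (2 * (Real.pi : ℂ)) * ∫ ω, z ω ^ 2 * E ω = _
  rw [hzero, hgauss]
  norm_cast
  field_simp
  rw [hπ]
  ring
end
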